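/- Let n > p ≥ 1, let Σ ⊆ ℝⁿ be a coherent closed set with 0 ∈ Σ, and let φ = (φ₁,…,φ_p) : ℝⁿ → ℝᵖ be real analytic near 0 with φ(0)=0. Then m_Σ^∞ ⊆ I_K(φ) holds if and only if m_Σ^∞ ⊆ I_T(φ) holds, i.e. every C^∞ function near 0 all of whose partial derivatives of every order vanish at all points of Σ near 0 is a C^∞-combination of the generators of I_K(φ) near 0 if and only if it is a C^∞-combination of the generators of I_T(φ) near 0. -/

import Mathlib

/-- The `p × p` Jacobian minor of `φ` with columns `ι` (a generator of `I_K(φ)`). -/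
noncomputable def kGen (n p : ℕ) (φ : EuclideanSpace ℝ (Fin n) → EuclideanSpace ℝ (Fin p))
    (ι : Fin p → Fin n) (x : EuclideanSpace ℝ (Fin n)) : ℝ :=
  Matrix.det fun j k : Fin p => fderiv ℝ φ x (EuclideanSpace.single (ι k) 1) j

/-- The `(p+1) × (p+1)` Jacobian minor of `(φ, ρ)`, `ρ(x) = ‖x‖²`, with columns `ι`
(a generator of `I_T(φ)`). -/
noncomputable def tGen (n p : ℕ) (φ : EuclideanSpace ℝ (Fin n) → EuclideanSpace ℝ (Fin p))
    (ι : Fin (p + 1) → Fin n) (x : EuclideanSpace ℝ (Fin n)) : ℝ :=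
  Matrix.det fun j k : Fin (p + 1) =>
    if h : (j : ℕ) < p then fderiv ℝ φ x (EuclideanSpace.single (ι k) 1) ⟨j, h⟩
    else 2 * x (ι k)

open scoped Classical in
/-- `h` belongs to the ideal `I_K(φ)` of germs at `0` of `C^∞` functions: near `0`,
`h` is a combination with `C^∞` coefficients of `φ₁, …, φ_p` and the `p × p`
Jacobian minors of `φ`. -/
def MemIK (n p : ℕ) (φ : EuclideanSpace ℝ (Fin n) → EuclideanSpace ℝ (Fin p))
    (h : EuclideanSpace ℝ (Fin n) → ℝ) : Prop :=
  ∃ U ∈ nhds (0 : EuclideanSpace ℝ (Fin n)),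
    ∃ a : Fin p → EuclideanSpace ℝ (Fin n) → ℝ,
      ∃ b : (Fin p → Fin n) → EuclideanSpace ℝ (Fin n) → ℝ,
        (∀ j, ContDiffOn ℝ (⊤ : ℕ∞) (a j) U) ∧ (∀ ι, ContDiffOn ℝ (⊤ : ℕ∞) (b ι) U) ∧
          ∀ x ∈ U, h x = (∑ j, a j x * φ x j) +
            ∑ ι : Fin p → Fin n, if StrictMono ι then b ι x * kGen n p φ ι x else 0

open scoped Classical in
/-- `h` belongs to the ideal `I_T(φ)` of germs at `0` of `C^∞` functions: near `0`,
`h` is a combination with `C^∞` coefficients of `φ₁, …, φ_p` and the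
`(p+1) × (p+1)` Jacobian minors of `(φ, ρ)`, `ρ(x) = ‖x‖²`. -/
def MemIT (n p : ℕ) (φ : EuclideanSpace ℝ (Fin n) → EuclideanSpace ℝ (Fin p))
    (h : EuclideanSpace ℝ (Fin n) → ℝ) : Prop :=
  ∃ U ∈ nhds (0 : EuclideanSpace ℝ (Fin n)),
    ∃ a : Fin p → EuclideanSpace ℝ (Fin n) → ℝ,
      ∃ b : (Fin (p + 1) → Fin n) → EuclideanSpace ℝ (Fin n) → ℝ,
        (∀ j, ContDiffOn ℝ (⊤ : ℕ∞) (a j) U) ∧ (∀ ι, ContDiffOn ℝ (⊤ : ℕ∞) (b ι) U) ∧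
          ∀ x ∈ U, h x = (∑ j, a j x * φ x j) +
            ∑ ι : Fin (p + 1) → Fin n, if StrictMono ι then b ι x * tGen n p φ ι x else 0

/-- `h` belongs to `m_Σ^∞`: `h` is `C^∞` near `0` and all its partial derivatives of
every order vanish at all points of `S` near `0`. -/
def FlatOnSet (n : ℕ) (S : Set (EuclideanSpace ℝ (Fin n)))
    (h : EuclideanSpace ℝ (Fin n) → ℝ) : Prop :=
  ∃ U ∈ nhds (0 : EuclideanSpace ℝ (Fin n)), ContDiffOn ℝ (⊤ : ℕ∞) h U ∧
    ∀ k : ℕ, ∀ x ∈ S ∩ U, iteratedFDeriv ℝ k h x = 0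

/-- The closed set `S` is coherent: there are finitely many `C^∞` functions vanishing
on `S` near `0` such that every `C^∞` function vanishing on `S` near `0` is, near `0`,
a combination of them with `C^∞` coefficients. -/
def CoherentSet (n : ℕ) (S : Set (EuclideanSpace ℝ (Fin n))) : Prop :=
  ∃ N : ℕ, ∃ q : Fin N → EuclideanSpace ℝ (Fin n) → ℝ,
    (∃ U ∈ nhds (0 : EuclideanSpace ℝ (Fin n)),
      (∀ i, ContDiffOn ℝ (⊤ : ℕ∞) (q i) U) ∧ ∀ i, ∀ x ∈ S ∩ U, q i x = 0) ∧
    ∀ h : EuclideanSpace ℝ (Fin n) → ℝ,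
      (∃ V ∈ nhds (0 : EuclideanSpace ℝ (Fin n)),
        ContDiffOn ℝ (⊤ : ℕ∞) h V ∧ ∀ x ∈ S ∩ V, h x = 0) →
      ∃ W ∈ nhds (0 : EuclideanSpace ℝ (Fin n)),
        ∃ a : Fin N → EuclideanSpace ℝ (Fin n) → ℝ,
          (∀ i, ContDiffOn ℝ (⊤ : ℕ∞) (a i) W) ∧ ∀ x ∈ W, h x = ∑ i, a i x * q i x

open scoped Classical in
/-- The ideal `I_K(φ)` is `Σ`-elliptic: some combination `F` of its generators with
`C^∞` coefficients satisfies `|F(x)| ≥ C · d(x, S)^α` near `0`. -/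
def IKElliptic (n p : ℕ) (S : Set (EuclideanSpace ℝ (Fin n)))
    (φ : EuclideanSpace ℝ (Fin n) → EuclideanSpace ℝ (Fin p)) : Prop :=
  ∃ U ∈ nhds (0 : EuclideanSpace ℝ (Fin n)),
    ∃ a : Fin p → EuclideanSpace ℝ (Fin n) → ℝ,
      ∃ b : (Fin p → Fin n) → EuclideanSpace ℝ (Fin n) → ℝ,
        (∀ j, ContDiffOn ℝ (⊤ : ℕ∞) (a j) U) ∧ (∀ ι, ContDiffOn ℝ (⊤ : ℕ∞) (b ι) U) ∧
          ∃ C > (0 : ℝ), ∃ α > (0 : ℝ), ∀ x ∈ U,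
            C * Metric.infDist x S ^ α ≤
              |(∑ j, a j x * φ x j) +
                ∑ ι : Fin p → Fin n, if StrictMono ι then b ι x * kGen n p φ ι x else 0|

section AnalyticGerms

open Filter Topology

/-- Functional calculus. -/
theorem exists_functional_calculus {E ι B : Type} [NormedAddCommGroup E] [NormedSpace ℝ E]
    [Fintype ι] [NormedRing B] [NormedAlgebra ℝ B] [CompleteSpace B]
    (b : Module.Basis ι ℝ E) {f : E → ℝ} (hf : AnalyticAt ℝ f 0) :
    ∃ F : (ι → B) → B, AnalyticAt ℝ F 0 ∧
      ∀ᶠ p : (ι → B) × E in 𝓝 0, ∀ (W : Type) [NormedAddCommGroup W] [NormedSpace ℝ W]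
        (Λ : B →L[ℝ] W), (∀ i T, Λ (p.1 i * T) = b.repr p.2 i • Λ T) →
          Λ (F p.1) = f p.2 • Λ 1 := by
  classical
  obtain ⟨p, hp⟩ := hf
  let P : FormalMultilinearSeries ℝ (ι → B) B := fun k =>
    ∑ w : Fin k → ι, p k (fun j => b (w j)) •
      (ContinuousMultilinearMap.mkPiAlgebraFin ℝ k B).compContinuousLinearMap
        (fun j => ContinuousLinearMap.proj (w j))
  obtain ⟨M, hM0, hM⟩ : ∃ M : ℝ, 0 ≤ M ∧ ∀ i, ‖b i‖ ≤ M :=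
    ⟨∑ i, ‖b i‖, by positivity,
      fun i => Finset.single_le_sum (f := fun i => ‖b i‖) (fun _ _ => norm_nonneg _)
        (Finset.mem_univ i)⟩
  have hPnorm : ∀ k, ‖P k‖ ≤ max 1 ‖(1 : B)‖ * ((Fintype.card ι * M) ^ k * ‖p k‖) := by
    intro k
    refine ContinuousMultilinearMap.opNorm_le_bound (by positivity) fun y => ?_
    have : ∀ w ∈ (Finset.univ : Finset (Fin k → ι)), ‖p k (fun j => b (w j)) •
        (List.ofFn fun j => y j (w j)).prod‖ ≤
          (‖p k‖ * M ^ k) * (max 1 ‖(1 : B)‖ * ∏ j, ‖y j‖) := by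
      intro w _
      rw [norm_smul]
      gcongr
      · refine (ContinuousMultilinearMap.le_opNorm _ _).trans ?_
        gcongr
        calc ∏ j, ‖b (w j)‖ ≤ ∏ _j : Fin k, M :=
              Finset.prod_le_prod (fun _ _ => norm_nonneg _) (fun _ _ => hM _)
          _ = M ^ k := by simp
      · rw [← ContinuousMultilinearMap.mkPiAlgebraFin_apply (R := ℝ)]
        refine (ContinuousMultilinearMap.le_opNorm _ _).trans ?_
        gcongr
        · exact ContinuousMultilinearMap.norm_mkPiAlgebraFin_le
        · exact norm_le_pi_norm _ _
    simp only [P, sum_apply, smul_apply,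
      ContinuousMultilinearMap.compContinuousLinearMap_apply,
      ContinuousMultilinearMap.mkPiAlgebraFin_apply, ContinuousLinearMap.proj_apply]
    refine (norm_sum_le_of_le Finset.univ this).trans (le_of_eq ?_)
    simp only [Finset.sum_const, Finset.card_univ, Fintype.card_fun, Fintype.card_fin, nsmul_eq_mul]
    push_cast
    ring
  have hrad : 0 < P.radius := by
    obtain ⟨r, hr0, hr⟩ := ENNReal.lt_iff_exists_nnreal_btwn.1 hp.radius_pos
    obtain ⟨C, hC0, hC⟩ := p.norm_mul_pow_le_of_lt_radius hr
    have hr0' : (0 : ℝ) < r := by exact_mod_cast hr0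
    have hden : (0 : ℝ) < Fintype.card ι * M + 1 := by positivity
    refine lt_of_lt_of_le ?_ (P.le_radius_of_bound (r := r / ⟨Fintype.card ι * M + 1, hden.le⟩)
      (max 1 ‖(1 : B)‖ * C) fun k => ?_)
    · rw [ENNReal.coe_pos]
      exact div_pos (by exact_mod_cast hr0) hden
    · calc ‖P k‖ * ((r / ⟨Fintype.card ι * M + 1, hden.le⟩ : NNReal) : ℝ) ^ k
          ≤ (max 1 ‖(1 : B)‖ * ((Fintype.card ι * M) ^ k * ‖p k‖)) *
            (r / (Fintype.card ι * M + 1)) ^ k := by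
            gcongr
            · exact hPnorm k
            · exact le_of_eq rfl
        _ = max 1 ‖(1 : B)‖ *
            ((Fintype.card ι * M / (Fintype.card ι * M + 1)) ^ k * (‖p k‖ * r ^ k)) := by
            rw [div_pow, div_pow]; field_simp
        _ ≤ max 1 ‖(1 : B)‖ * (1 * C) := by
            gcongr
            · exact pow_le_one₀ (by positivity) ((div_le_one hden).2 (by linarith))
            · exact hC k
        _ = _ := by ring
  have hPs := P.hasFPowerSeriesOnBall hrad
  refine ⟨P.sum, hPs.hasFPowerSeriesAt.analyticAt, ?_⟩
  have h1 : ∀ᶠ q : (ι → B) × E in 𝓝 0, HasSum (fun k => P k fun _ => q.1) (P.sum q.1) := by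
    have := (continuous_fst.tendsto' (0 : (ι → B) × E) 0 rfl).eventually
      hPs.hasFPowerSeriesAt.eventually_hasSum
    simpa using this
  have h2 : ∀ᶠ q : (ι → B) × E in 𝓝 0, HasSum (fun k => p k fun _ => q.2) (f q.2) := by
    have := (continuous_snd.tendsto' (0 : (ι → B) × E) 0 rfl).eventually
      hp.eventually_hasSum
    simpa using this
  filter_upwards [h1, h2] with q hq1 hq2 W _ _ Λ he
  have hprod : ∀ (k : ℕ) (w : Fin k → ι),
      Λ (List.ofFn fun j => q.1 (w j)).prod = (∏ j, b.repr q.2 (w j)) • Λ 1 := by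
    intro k
    induction k with
    | zero => intro w; simp
    | succ k ih =>
      intro w
      rw [List.ofFn_succ, List.prod_cons, he, ih, smul_smul, Fin.prod_univ_succ]
  have hterm : ∀ k, Λ (P k fun _ => q.1) = (p k fun _ => q.2) • Λ 1 := by
    intro k
    have : (p k fun _ => q.2) =
        ∑ w : Fin k → ι, (∏ j, b.repr q.2 (w j)) * p k (fun j => b (w j)) := by
      conv_lhs => rw [← b.sum_repr q.2]
      rw [ContinuousMultilinearMap.map_sum]
      refine Finset.sum_congr rfl fun w _ => ?_
      rw [ContinuousMultilinearMap.map_smul_univ]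
      simp
    rw [this, Finset.sum_smul]
    simp only [P, sum_apply, smul_apply,
      ContinuousMultilinearMap.compContinuousLinearMap_apply,
      ContinuousMultilinearMap.mkPiAlgebraFin_apply, ContinuousLinearMap.proj_apply]
    rw [map_sum]
    refine Finset.sum_congr rfl fun w _ => ?_
    rw [map_smul, hprod, smul_smul, mul_comm]
  have hs1 := hq1.mapL Λ
  have hs2 := hq2.smul_const (Λ 1)
  simp only [hterm] at hs1
  exact hs1.unique hs2

/-- A Banach space with a left shift `L`, a right shift `R`, a head functional and a unit vector,
behaving like a space of real sequences. -/
structure ShiftSpace (X : Type) [NormedAddCommGroup X] [NormedSpace ℝ X] where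
  L : X →L[ℝ] X
  R : X →L[ℝ] X
  head : X →L[ℝ] ℝ
  unit : X
  L_R : ∀ a, L (R a) = a
  L_unit : L unit = 0
  head_unit : head unit = 1
  eq_R_add : ∀ a, a = R (L a) + head a • unit
  eq_zero : ∀ a, (∀ k : ℕ, head ((L ^ k) a) = 0) → a = 0

namespace ShiftSpace

section

open BoundedContinuousFunction

theorem exists_shiftSpace : ∃ (X : Type) (_ : NormedAddCommGroup X) (_ : NormedSpace ℝ X)
    (_ : CompleteSpace X), Nonempty (ShiftSpace X) := by
  let l : (ℕ →ᵇ ℝ) →L[ℝ] (ℕ →ᵇ ℝ) := LinearMap.mkContinuous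
    { toFun := fun a => a.compContinuous ⟨Nat.succ, continuous_of_discreteTopology⟩
      map_add' := fun _ _ => rfl
      map_smul' := fun _ _ => rfl } 1 fun a => by
    rw [one_mul]
    exact (BoundedContinuousFunction.norm_le (norm_nonneg a)).2 fun k => a.norm_coe_le_norm (k + 1)
  let r : (ℕ →ᵇ ℝ) →L[ℝ] (ℕ →ᵇ ℝ) := LinearMap.mkContinuous
    { toFun := fun a => BoundedContinuousFunction.ofNormedAddCommGroupDiscrete
        (fun k => Nat.casesOn k 0 a) ‖a‖ fun k => by
          cases k
          · simp
          · exact a.norm_coe_le_norm _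
      map_add' := fun a b => by ext k; cases k <;> simp
      map_smul' := fun c a => by ext k; cases k <;> simp } 1 fun a => by
    rw [one_mul]
    refine (BoundedContinuousFunction.norm_le (norm_nonneg a)).2 fun k => ?_
    cases k
    · simp
    · exact a.norm_coe_le_norm _
  let u : ℕ →ᵇ ℝ := BoundedContinuousFunction.ofNormedAddCommGroupDiscrete
    (fun k => Nat.casesOn k 1 fun _ => 0) 1 fun k => by cases k <;> simp
  have hl : ∀ (a : ℕ →ᵇ ℝ) k, l a k = a (k + 1) := fun _ _ => rfl
  have hr : ∀ (a : ℕ →ᵇ ℝ) k, r a (k + 1) = a k := fun _ _ => rfl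
  have hr0 : ∀ (a : ℕ →ᵇ ℝ), r a 0 = 0 := fun _ => rfl
  have hu : ∀ k, u (k + 1) = 0 := fun _ => rfl
  have hu0 : u 0 = 1 := rfl
  have hlk : ∀ (k : ℕ) (a : ℕ →ᵇ ℝ), ((l ^ k) a) 0 = a k := by
    intro k
    induction k with
    | zero => intro a; rfl
    | succ k ih =>
      intro a
      rw [pow_succ, mul_apply_eq_comp, ih, hl]
  refine ⟨ℕ →ᵇ ℝ, inferInstance, inferInstance, inferInstance,
    ⟨⟨l, r, BoundedContinuousFunction.evalCLM ℝ 0, u, ?_, ?_, rfl, ?_, ?_⟩⟩⟩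
  · intro a; ext k; rfl
  · ext k; rfl
  · intro a
    ext k
    rw [BoundedContinuousFunction.add_apply, BoundedContinuousFunction.smul_apply,
      BoundedContinuousFunction.evalCLM_apply]
    cases k with
    | zero => rw [hr0, hu0]; simp
    | succ k => rw [hr, hl, hu]; simp
  · intro a h
    ext k
    rw [← hlk]
    exact h k

end

variable {X : Type} [NormedAddCommGroup X] [NormedSpace ℝ X] (s : ShiftSpace X)

theorem head_R (a : X) : s.head (s.R a) = 0 := by
  have h := s.eq_R_add (s.R a)
  rw [s.L_R] at h
  have h2 : s.head (s.R a) • s.unit = 0 := by simpa using h.symm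
  have := congrArg s.head h2
  simpa [s.head_unit] using this

/-- The evaluation `a ↦ ∑ aₖ ζ ^ k`, for small `ζ`. -/
noncomputable def eval (ζ : ℝ) : X →L[ℝ] ℝ := s.head.comp (Ring.inverse (1 - ζ • s.L))

theorem L_pow_R_pow (k : ℕ) (a : X) : (s.L ^ k) ((s.R ^ k) a) = a := by
  induction k generalizing a with
  | zero => rfl
  | succ k ih =>
    rw [pow_succ, pow_succ', mul_apply_eq_comp,
      mul_apply_eq_comp, s.L_R, ih]

theorem eq_sum_of_L_pow_eq_zero (k : ℕ) (a : X) :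
    a = (s.R ^ k) ((s.L ^ k) a) +
      ∑ j ∈ Finset.range k, s.head ((s.L ^ j) a) • (s.R ^ j) s.unit := by
  induction k with
  | zero => simp
  | succ k ih =>
    conv_lhs => rw [ih, s.eq_R_add ((s.L ^ k) a)]
    rw [Finset.sum_range_succ, map_add, map_smul, pow_succ, pow_succ',
      mul_apply_eq_comp, mul_apply_eq_comp]
    abel

variable [CompleteSpace X]

theorem analyticAt_eval : AnalyticAt ℝ s.eval 0 := by
  have h : AnalyticAt ℝ (fun ζ : ℝ => Ring.inverse (1 - ζ • s.L)) 0 := by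
    have h0 : AnalyticAt ℝ (Ring.inverse : (X →L[ℝ] X) → _) (1 - (0 : ℝ) • s.L) := by
      simpa using analyticAt_inverse (𝕜 := ℝ) (1 : (X →L[ℝ] X)ˣ)
    have h1 : AnalyticAt ℝ (fun ζ : ℝ => 1 - ζ • s.L) 0 :=
      analyticAt_const.sub (analyticAt_id.smul analyticAt_const)
    exact AnalyticAt.fun_comp (f := fun ζ : ℝ => 1 - ζ • s.L) h0 h1
  exact (ContinuousLinearMap.analyticAt (ContinuousLinearMap.compL ℝ X X ℝ s.head) _).fun_comp h

theorem eventually_eval :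
    ∀ᶠ ζ in 𝓝 (0 : ℝ), ∀ a, s.eval ζ a = s.head a + ζ * s.eval ζ (s.L a) := by
  have h : ∀ᶠ ζ in 𝓝 (0 : ℝ), IsUnit (1 - ζ • s.L) := by
    have hc : Tendsto (fun ζ : ℝ => 1 - ζ • s.L) (𝓝 0) (𝓝 1) :=
      Continuous.tendsto' (by fun_prop) _ _ (by simp)
    exact hc.eventually (Units.isOpen.mem_nhds isUnit_one)
  filter_upwards [h] with ζ hζ a
  have : (s.eval ζ).comp (1 - ζ • s.L) = s.head := by
    rw [eval, ContinuousLinearMap.comp_assoc, ← ContinuousLinearMap.mul_def,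
      Ring.inverse_mul_cancel _ hζ]
    rfl
  have h2 := congrArg (fun T : X →L[ℝ] ℝ => T a) this
  simp at h2
  linarith

theorem eventually_eval_R :
    ∀ᶠ ζ in 𝓝 (0 : ℝ), ∀ a, s.eval ζ (s.R a) = ζ * s.eval ζ a := by
  filter_upwards [s.eventually_eval] with ζ h a
  rw [h, s.head_R, s.L_R, zero_add]

theorem eventually_eval_unit : ∀ᶠ ζ in 𝓝 (0 : ℝ), s.eval ζ s.unit = 1 := by
  filter_upwards [s.eventually_eval] with ζ h
  rw [h, s.head_unit, s.L_unit, map_zero, mul_zero, add_zero]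

theorem eq_zero_of_eval {a : X} (h : ∀ᶠ ζ in 𝓝 (0 : ℝ), s.eval ζ a = 0) : a = 0 := by
  have hz : ∀ c : X, (∀ᶠ ζ in 𝓝[≠] (0 : ℝ), s.eval ζ c = 0) → s.head c = 0 := by
    intro c hc
    have hcont : Tendsto (fun ζ => s.eval ζ c) (𝓝[≠] 0) (𝓝 (s.eval 0 c)) :=
      ((s.analyticAt_eval.continuousAt.clm_apply continuousAt_const).tendsto).mono_left
        nhdsWithin_le_nhds
    have h0 : s.eval 0 c = 0 := tendsto_nhds_unique hcont
      (tendsto_const_nhds.congr' (hc.mono fun _ h => h.symm))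
    have := s.eventually_eval.self_of_nhds c
    simpa [h0] using this.symm
  have key : ∀ k : ℕ, ∀ᶠ ζ in 𝓝[≠] (0 : ℝ), s.eval ζ ((s.L ^ k) a) = 0 := by
    intro k
    induction k with
    | zero => simpa using h.filter_mono nhdsWithin_le_nhds
    | succ k ih =>
      filter_upwards [ih, s.eventually_eval.filter_mono nhdsWithin_le_nhds, self_mem_nhdsWithin]
        with ζ h1 h2 h3
      rw [h2, hz _ ih, zero_add] at h1
      rw [pow_succ', mul_apply_eq_comp]
      exact (mul_eq_zero.1 h1).resolve_left h3
  exact s.eq_zero a fun k => hz _ (key k)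

end ShiftSpace

theorem analyticAt_clm_apply {E F G : Type} [NormedAddCommGroup E] [NormedSpace ℝ E]
    [NormedAddCommGroup F] [NormedSpace ℝ F] [NormedAddCommGroup G] [NormedSpace ℝ G]
    {c : E → F →L[ℝ] G} {v : E → F} {x : E} (hc : AnalyticAt ℝ c x) (hv : AnalyticAt ℝ v x) :
    AnalyticAt ℝ (fun y => c y (v y)) x :=
  AnalyticAt.fun_comp (f := fun y => (c y, v y))
    ((ContinuousLinearMap.id ℝ (F →L[ℝ] G)).analyticAt_bilinear (c x, v x)) (hc.prod hv)

/-- Analytic functions on `E × ℝ` act on sequence spaces, the last variable acting as a multiple of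
the right shift. -/
theorem ShiftSpace.exists_action {E X : Type} [NormedAddCommGroup E] [NormedSpace ℝ E]
    [FiniteDimensional ℝ E] [NormedAddCommGroup X] [NormedSpace ℝ X] [CompleteSpace X]
    (s : ShiftSpace X) {f : E × ℝ → ℝ} (hf : AnalyticAt ℝ f 0) :
    ∀ᶠ ε in 𝓝[≠] (0 : ℝ), ∃ Φ : E → X →L[ℝ] X, AnalyticAt ℝ Φ 0 ∧ (f 0 ≠ 0 → IsUnit (Φ 0)) ∧
      ∀ᶠ x : E × ℝ in 𝓝 0, ∀ a, s.eval (x.2 / ε) (Φ x.1 a) = f x * s.eval (x.2 / ε) a := by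
  let b := Module.finBasis ℝ (E × ℝ)
  obtain ⟨F, hF, hFe⟩ := exists_functional_calculus (B := X →L[ℝ] X) b hf
  have hF0 : F 0 = f 0 • 1 := by
    have := hFe.self_of_nhds (X →L[ℝ] X) (ContinuousLinearMap.id ℝ _) (by simp)
    simpa using this
  let y : ℝ → E → Fin (Module.finrank ℝ (E × ℝ)) → X →L[ℝ] X := fun ε x' i =>
    b.repr (x', 0) i • (1 : X →L[ℝ] X) + (b.repr (0, 1) i * ε) • s.R
  have hy0 : Tendsto (fun ε => y ε 0) (𝓝 0) (𝓝 0) := by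
    have hc : Continuous fun ε : ℝ => y ε 0 := by
      refine continuous_pi fun i => ?_
      exact continuous_const.add ((continuous_const.mul continuous_id).smul continuous_const)
    refine hc.tendsto' _ _ ?_
    ext1 i
    simp [y, Prod.mk_zero_zero]
  have hy0' := hy0.mono_left (nhdsWithin_le_nhds (s := {0}ᶜ))
  have hy1 : Tendsto (fun ε => (y ε 0, (0 : E × ℝ))) (𝓝[≠] 0) (𝓝 0) :=
    hy0'.prodMk_nhds tendsto_const_nhds
  have hu : f 0 ≠ 0 → ∀ᶠ ε in 𝓝[≠] (0 : ℝ), IsUnit (F (y ε 0)) := by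
    intro h0
    have h1 : IsUnit (F 0) := by
      rw [hF0, ← Algebra.algebraMap_eq_smul_one]
      exact (IsUnit.mk0 _ h0).map _
    exact (hF.continuousAt.tendsto.comp hy0').eventually (Units.isOpen.mem_nhds h1)
  have hu' : ∀ᶠ ε in 𝓝[≠] (0 : ℝ), f 0 ≠ 0 → IsUnit (F (y ε 0)) := by
    by_cases h0 : f 0 = 0
    · simp [h0]
    · filter_upwards [hu h0] with ε hε _ using hε
  filter_upwards [hu', hy0'.eventually hF.eventually_analyticAt,
    hy1.eventually (eventually_eventually_nhds.2 hFe), self_mem_nhdsWithin] with ε h1 h2 h3 hε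
  have hya : AnalyticAt ℝ (y ε) 0 := by
    rw [analyticAt_pi_iff]
    intro i
    refine AnalyticAt.fun_add (AnalyticAt.fun_smul ?_ analyticAt_const) analyticAt_const
    exact ContinuousLinearMap.analyticAt (LinearMap.toContinuousLinearMap
      ((b.coord i).comp (LinearMap.inl ℝ E ℝ))) 0
  refine ⟨fun x' => F (y ε x'), h2.comp hya, h1, ?_⟩
  have hlim : Tendsto (fun x : E × ℝ => (y ε x.1, x)) (𝓝 0) (𝓝 (y ε 0, 0)) :=
    ((hya.continuousAt.tendsto).comp (continuous_fst.tendsto' (0 : E × ℝ) 0 rfl)).prodMk_nhds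
      tendsto_id
  have hζ : Tendsto (fun x : E × ℝ => x.2 / ε) (𝓝 0) (𝓝 0) :=
    (continuous_snd.div_const ε).tendsto' _ _ (by simp)
  filter_upwards [hlim.eventually h3, hζ.eventually s.eventually_eval_R] with x hx hR a
  have := hx _ (ContinuousLinearMap.compL ℝ X X ℝ (s.eval (x.2 / ε))) fun i T => by
    ext c
    have hx2 : b.repr x i = b.repr (x.1, 0) i + x.2 * b.repr (0, 1) i := by
      have : x = (x.1, 0) + x.2 • ((0 : E), (1 : ℝ)) := by ext <;> simp
      conv_lhs => rw [this, map_add, map_smul]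
      simp
    have hε' : ε ≠ 0 := hε
    simp only [y, ContinuousLinearMap.compL_apply, ContinuousLinearMap.comp_apply,
      mul_apply_eq_comp, add_apply, smul_apply, map_add, map_smul, hR, hx2, smul_eq_mul,
      one_apply_eq_self]
    field_simp
  have h4 := congrArg (fun T : X →L[ℝ] ℝ => T a) this
  simpa using h4

/-- The Weierstrass division theorem for real analytic functions. -/
theorem weierstrass_division {E : Type} [NormedAddCommGroup E] [NormedSpace ℝ E]
    [FiniteDimensional ℝ E] {g : E × ℝ → ℝ} (hg : AnalyticAt ℝ g 0) {d : ℕ} {h : ℝ → ℝ}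
    (hh : AnalyticAt ℝ h 0) (hh0 : h 0 ≠ 0) (hgh : ∀ᶠ t in 𝓝 (0 : ℝ), g (0, t) = t ^ d * h t)
    {f : E × ℝ → ℝ} (hf : AnalyticAt ℝ f 0) :
    ∃ (q : E × ℝ → ℝ) (r : ℕ → E → ℝ), AnalyticAt ℝ q 0 ∧ (∀ j, AnalyticAt ℝ (r j) 0) ∧
      ∀ᶠ x : E × ℝ in 𝓝 0, f x = q x * g x + ∑ j ∈ Finset.range d, r j x.1 * x.2 ^ j := by
  obtain ⟨X, _, _, _, ⟨s⟩⟩ := ShiftSpace.exists_shiftSpace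
  have hh' : AnalyticAt ℝ (fun x : E × ℝ => h x.2) 0 :=
    AnalyticAt.fun_comp (g := h) (f := Prod.snd) hh analyticAt_snd
  obtain ⟨ε, ⟨Φg, hΦg, -, hge⟩, ⟨Φf, hΦf, -, hfe⟩, ⟨Φh, -, hunit, hhe⟩, hε⟩ :=
    ((s.exists_action hg).and ((s.exists_action hf).and ((s.exists_action hh').and
      self_mem_nhdsWithin))).exists
  have hε : ε ≠ 0 := hε
  have hζ : Tendsto (fun x : E × ℝ => x.2 / ε) (𝓝 0) (𝓝 0) :=
    (continuous_snd.div_const ε).tendsto' _ _ (by simp)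
  have hG0 : ∀ a, Φg 0 a = ε ^ d • (s.R ^ d) (Φh 0 a) := by
    intro a
    rw [← sub_eq_zero]
    apply s.eq_zero_of_eval
    have hl : Tendsto (fun ζ : ℝ => ((0 : E), ε * ζ)) (𝓝 0) (𝓝 0) :=
      Continuous.tendsto' (by fun_prop) _ _ (by simp)
    have hl' : Tendsto (fun ζ : ℝ => ε * ζ) (𝓝 0) (𝓝 0) :=
      Continuous.tendsto' (by fun_prop) _ _ (by simp)
    filter_upwards [hl.eventually hge, hl.eventually hhe, hl'.eventually hgh, s.eventually_eval_R]
      with ζ h1 h2 h3 h4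
    simp only [mul_div_cancel_left₀ _ hε] at h1 h2
    have h5 : ∀ (k : ℕ) c, s.eval ζ ((s.R ^ k) c) = ζ ^ k * s.eval ζ c := by
      intro k c
      induction k with
      | zero => simp
      | succ k ih => rw [pow_succ', mul_apply_eq_comp, h4, ih, pow_succ']; ring
    rw [map_sub, map_smul, h5, h1, h2, h3, smul_eq_mul]
    ring
  have hU : AnalyticAt ℝ (fun x' => s.L ^ d * Φg x') 0 := analyticAt_const.mul hΦg
  have hU0 : IsUnit (s.L ^ d * Φg 0) := by
    have : s.L ^ d * Φg 0 = algebraMap ℝ _ (ε ^ d) * Φh 0 := by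
      ext a
      rw [Algebra.algebraMap_eq_smul_one, smul_mul_assoc, one_mul, mul_apply_eq_comp, hG0, map_smul,
        s.L_pow_R_pow, smul_apply]
    rw [this]
    exact ((IsUnit.mk0 _ (pow_ne_zero d hε)).map _).mul (hunit hh0)
  have hinv : AnalyticAt ℝ (fun x' => Ring.inverse (s.L ^ d * Φg x')) 0 := by
    obtain ⟨v, hv⟩ := hU0
    refine AnalyticAt.fun_comp (f := fun x' => s.L ^ d * Φg x') ?_ hU
    rw [← hv]
    exact analyticAt_inverse v
  have hUe : ∀ᶠ x' in 𝓝 (0 : E), IsUnit (s.L ^ d * Φg x') :=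
    hU.continuousAt.eventually (Units.isOpen.mem_nhds hU0)
  let w : E → X := fun x' => Ring.inverse (s.L ^ d * Φg x') ((s.L ^ d) (Φf x' s.unit))
  have hw : AnalyticAt ℝ w 0 :=
    analyticAt_clm_apply hinv (analyticAt_clm_apply analyticAt_const
      (analyticAt_clm_apply hΦf analyticAt_const))
  let ρ : E → X := fun x' => Φf x' s.unit - Φg x' (w x')
  have hρ : AnalyticAt ℝ ρ 0 := (analyticAt_clm_apply hΦf analyticAt_const).fun_sub
    (analyticAt_clm_apply hΦg hw)
  have hρ0 : ∀ᶠ x' in 𝓝 (0 : E), (s.L ^ d) (ρ x') = 0 := by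
    filter_upwards [hUe] with x' hx
    have := congrArg (fun T : X →L[ℝ] X => T ((s.L ^ d) (Φf x' s.unit)))
      (Ring.mul_inverse_cancel _ hx)
    simp only [mul_apply_eq_comp, one_apply_eq_self] at this
    simp only [ρ, map_sub, w]
    rw [this, sub_self]
  refine ⟨fun x => s.eval (x.2 / ε) (w x.1), fun j x' => s.head ((s.L ^ j) (ρ x')) / ε ^ j,
    ?_, fun j => ?_, ?_⟩
  · refine analyticAt_clm_apply ?_ ?_
    · refine AnalyticAt.fun_comp (f := fun x : E × ℝ => x.2 / ε) ?_ ?_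
      · simpa using s.analyticAt_eval
      · exact analyticAt_snd.div analyticAt_const hε
    · exact AnalyticAt.fun_comp (f := fun x : E × ℝ => x.1) hw analyticAt_fst
  · exact (analyticAt_clm_apply analyticAt_const (analyticAt_clm_apply analyticAt_const hρ)).fun_div
      analyticAt_const
      (pow_ne_zero j hε)
  · filter_upwards [hge, hfe, hζ.eventually s.eventually_eval_unit,
      hζ.eventually s.eventually_eval_R,
      (continuous_fst.tendsto' (0 : E × ℝ) 0 rfl).eventually hρ0] with x h1 h2 h3 h4 h5
    have h6 : ∀ (k : ℕ) c, s.eval (x.2 / ε) ((s.R ^ k) c) = (x.2 / ε) ^ k * s.eval (x.2 / ε) c := by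
      intro k c
      induction k with
      | zero => simp
      | succ k ih => rw [pow_succ', mul_apply_eq_comp, h4, ih, pow_succ']; ring
    have h7 := s.eq_sum_of_L_pow_eq_zero d (ρ x.1)
    rw [h5, map_zero, zero_add] at h7
    have h8 : Φf x.1 s.unit = ρ x.1 + Φg x.1 (w x.1) := by simp [ρ]
    have h9 := h2 s.unit
    rw [h3, mul_one, h8, map_add, h1] at h9
    rw [← h9, add_comm, mul_comm]
    congr 1
    conv_lhs => rw [h7, map_sum]
    refine Finset.sum_congr rfl fun j _ => ?_
    rw [map_smul, h6, h3, smul_eq_mul, div_pow]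
    field_simp

section

open Polynomial
open scoped TensorProduct

/-- A derivation extends along a formally étale algebra. -/
theorem Derivation.exists_extension {R S T M : Type} [CommRing R] [CommRing S] [CommRing T]
    [Algebra R S] [Algebra R T] [Algebra S T] [IsScalarTower R S T] [Algebra.FormallyEtale S T]
    [AddCommGroup M] [Module R M] [Module S M] [Module T M] [IsScalarTower S T M]
    [IsScalarTower R S M] [IsScalarTower R T M] (D : Derivation R S M) :
    ∃ D' : Derivation R T M, ∀ s, D' (algebraMap S T s) = D s := by
  let l : T ⊗[S] Ω[S⁄R] →ₗ[T] M := D.liftKaehlerDifferential.liftBaseChange T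
  refine ⟨(l.comp
    (KaehlerDifferential.tensorKaehlerEquivOfFormallyEtale R S T).symm.toLinearMap).compDer
    (KaehlerDifferential.D R T), fun s => ?_⟩
  have := KaehlerDifferential.tensorKaehlerEquivOfFormallyEtale_symm_D_algebraMap R S T s
  change l ((KaehlerDifferential.tensorKaehlerEquivOfFormallyEtale R S T).symm
    (KaehlerDifferential.D R T (algebraMap S T s))) = D s
  rw [this]
  simp [l]

/-- If a derivation kills an element algebraic over `L`, it kills the coefficients of its minimal
polynomial. -/
theorem Derivation.apply_coeff_minpoly_eq_zero {L F : Type} [Field L] [Field F] [Algebra ℝ L]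
    [Algebra ℝ F] [Algebra L F] [IsScalarTower ℝ L F] (δL : Derivation ℝ L L)
    (δ : Derivation ℝ F F) (h : ∀ c, δ (algebraMap L F c) = algebraMap L F (δL c)) {u : F}
    (hu : IsIntegral L u) (h0 : δ u = 0) (i : ℕ) : δL ((minpoly L u).coeff i) = 0 := by
  set m := minpoly L u with hm
  let w : L[X] := ∑ j ∈ Finset.range m.natDegree, Polynomial.monomial j (δL (m.coeff j))
  have hmonic : m.Monic := minpoly.monic hu
  have h1 : Polynomial.aeval u w = 0 := by
    have e1 : Polynomial.aeval u m =
        ∑ j ∈ Finset.range (m.natDegree + 1), algebraMap L F (m.coeff j) * u ^ j := by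
      rw [Polynomial.aeval_eq_sum_range]
      simp [Algebra.smul_def]
    have e2 := congrArg δ e1
    rw [minpoly.aeval, map_zero, map_sum, Finset.sum_range_succ] at e2
    have e3 : ∀ j, δ (algebraMap L F (m.coeff j) * u ^ j) =
        algebraMap L F (δL (m.coeff j)) * u ^ j := by
      intro j
      rw [Derivation.leibniz, Derivation.leibniz_pow, h0, h]
      simp [mul_comm]
    simp only [e3] at e2
    have e4 : m.coeff m.natDegree = 1 := hmonic
    rw [e4, Derivation.map_one_eq_zero, map_zero, zero_mul, add_zero] at e2
    rw [e2]
    simp [w, Polynomial.aeval_monomial]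
  have h2 : w = 0 := by
    by_contra hw
    have := minpoly.degree_le_of_ne_zero L u hw h1
    have h3 : w.degree < m.natDegree := by
      refine (Polynomial.degree_sum_le _ _).trans_lt ?_
      rw [Finset.sup_lt_iff (WithBot.bot_lt_coe _)]
      intro j hj
      exact (Polynomial.degree_monomial_le _ _).trans_lt (by exact_mod_cast Finset.mem_range.1 hj)
    rw [← Polynomial.degree_eq_natDegree hmonic.ne_zero] at h3
    exact absurd h3 (not_lt.2 this)
  rcases lt_trichotomy i m.natDegree with hi | hi | hi
  · have := congrArg (fun q => q.coeff i) h2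
    simpa [w, Polynomial.finsetSum_coeff, Polynomial.coeff_monomial, hi] using this
  · have e4 : m.coeff m.natDegree = 1 := hmonic
    rw [hi, e4, Derivation.map_one_eq_zero]
  · rw [Polynomial.coeff_eq_zero_of_natDegree_lt hi, map_zero]

theorem isAlgebraic_of_coeff_minpoly {L F : Type} [Field L] [Field F] [Algebra ℝ L]
    [Algebra ℝ F] [Algebra L F] [IsScalarTower ℝ L F] {u : F}
    (hu : IsIntegral L u) (h : ∀ i, IsAlgebraic ℝ ((minpoly L u).coeff i)) : IsAlgebraic ℝ u := by
  refine IsIntegral.isAlgebraic (IsIntegral.of_aeval_monic_of_isIntegral_coeff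
    (p := (minpoly L u).map (algebraMap L F)) ((minpoly.monic hu).map _) ?_ ?_ fun i => ?_)
  · rw [Polynomial.natDegree_map]
    exact (minpoly.natDegree_pos hu).ne'
  · rw [Polynomial.eval_map_algebraMap, minpoly.aeval]
    exact isIntegral_zero
  · rw [Polynomial.coeff_map]
    exact (h i).isIntegral.map (IsScalarTower.toAlgHom ℝ L F)

section

variable (E : Type) [NormedAddCommGroup E] [NormedSpace ℝ E]

/-- The functions which are analytic at the origin. -/
def analyticAlg : Subalgebra ℝ (E → ℝ) where
  carrier := {f | AnalyticAt ℝ f 0}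
  mul_mem' := fun hf hg => AnalyticAt.mul hf hg
  add_mem' := fun hf hg => AnalyticAt.add hf hg
  algebraMap_mem' := fun _ => analyticAt_const

end

section

variable {E E₁ E₂ : Type} [NormedAddCommGroup E] [NormedSpace ℝ E]
  [NormedAddCommGroup E₁] [NormedSpace ℝ E₁] [NormedAddCommGroup E₂] [NormedSpace ℝ E₂]
  {F L : Type} [Field F] [Algebra ℝ F] [Field L] [Algebra ℝ L]

/-- Directional derivatives. -/
noncomputable def dirDeriv (w : E) (f : analyticAlg E) : analyticAlg E :=
  ⟨fun x => fderiv ℝ f.1 x w, analyticAt_clm_apply f.2.fderiv analyticAt_const⟩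

/-- Pullback along a linear map. -/
def pull (l : E₁ →L[ℝ] E₂) : analyticAlg E₂ →ₐ[ℝ] analyticAlg E₁ where
  toFun f := ⟨fun x => f.1 (l x), AnalyticAt.fun_comp (f := l)
    (by rw [map_zero]; exact f.2) (l.analyticAt 0)⟩
  map_one' := rfl
  map_mul' _ _ := rfl
  map_zero' := rfl
  map_add' _ _ := rfl
  commutes' _ := rfl

/-- The homomorphism `ev` only depends on germs at the origin. -/
def KillsZeroGerms (ev : analyticAlg E →ₐ[ℝ] F) : Prop :=
  ∀ f : analyticAlg E, f.1 =ᶠ[𝓝 0] 0 → ev f = 0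

theorem KillsZeroGerms.congr {ev : analyticAlg E →ₐ[ℝ] F} (hev : KillsZeroGerms ev)
    {f g : analyticAlg E} (h : f.1 =ᶠ[𝓝 0] g.1) : ev f = ev g := by
  rw [← sub_eq_zero, ← map_sub]
  refine hev _ ?_
  filter_upwards [h] with x hx
  change f.1 x - g.1 x = 0
  rw [hx, sub_self]

theorem KillsZeroGerms.pull {ev : analyticAlg E₁ →ₐ[ℝ] F} (hev : KillsZeroGerms ev)
    (l : E₁ →L[ℝ] E₂) : KillsZeroGerms (ev.comp (pull l)) := by
  intro f hf
  exact hev _ ((l.continuous.tendsto' 0 0 (map_zero l)).eventually hf)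

theorem KillsZeroGerms.apply_ne_zero {ev : analyticAlg E →ₐ[ℝ] F} (hev : KillsZeroGerms ev)
    {f : analyticAlg E} (hf : f.1 0 ≠ 0) : ev f ≠ 0 := by
  let g : analyticAlg E := ⟨fun x => (f.1 x)⁻¹, f.2.inv hf⟩
  have : ev (f * g) = ev 1 := by
    refine hev.congr ?_
    filter_upwards [f.2.continuousAt.eventually_ne hf] with x hx
    exact mul_inv_cancel₀ hx
  rw [map_mul, map_one] at this
  exact left_ne_zero_of_mul (this ▸ one_ne_zero)

theorem eventually_differentiableAt (f : analyticAlg E) :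
    ∀ᶠ x in 𝓝 0, DifferentiableAt ℝ f.1 x :=
  f.2.eventually_analyticAt.mono fun _ h => h.differentiableAt

/-- The directional derivative followed by `ev`. -/
noncomputable def evDeriv {ev : analyticAlg E →ₐ[ℝ] F} (hev : KillsZeroGerms ev) (w : E) :
    analyticAlg E →ₗ[ℝ] F where
  toFun f := ev (dirDeriv w f)
  map_add' f g := by
    rw [← map_add]
    refine hev.congr ?_
    filter_upwards [eventually_differentiableAt f, eventually_differentiableAt g] with x hf hg
    change fderiv ℝ (f.1 + g.1) x w = fderiv ℝ f.1 x w + fderiv ℝ g.1 x w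
    rw [fderiv_add hf hg]
    rfl
  map_smul' c f := by
    rw [RingHom.id_apply, ← map_smul]
    refine hev.congr ?_
    filter_upwards [eventually_differentiableAt f] with x hf
    change fderiv ℝ (c • f.1) x w = c • fderiv ℝ f.1 x w
    rw [fderiv_const_smul hf]
    rfl

/-- The `F`-linear combinations of directional derivatives. -/
noncomputable def tangent {ev : analyticAlg E →ₐ[ℝ] F} (hev : KillsZeroGerms ev) :
    Submodule F (analyticAlg E →ₗ[ℝ] F) :=
  Submodule.span F (Set.range (evDeriv hev))

theorem tangent_leibniz {ev : analyticAlg E →ₐ[ℝ] F} {hev : KillsZeroGerms ev}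
    {D : analyticAlg E →ₗ[ℝ] F} (hD : D ∈ tangent hev) (f g : analyticAlg E) :
    D (f * g) = ev f * D g + ev g * D f := by
  induction hD using Submodule.span_induction with
  | mem D hD =>
    obtain ⟨w, rfl⟩ := hD
    change ev _ = ev f * ev _ + ev g * ev _
    rw [← map_mul, ← map_mul, ← map_add]
    refine hev.congr ?_
    filter_upwards [eventually_differentiableAt f, eventually_differentiableAt g] with x hf hg
    change fderiv ℝ (f.1 * g.1) x w = f.1 x * fderiv ℝ g.1 x w + g.1 x * fderiv ℝ f.1 x w
    rw [fderiv_mul hf hg]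
    rfl
  | zero => simp
  | add D₁ D₂ _ _ h₁ h₂ => simp only [LinearMap.add_apply, h₁, h₂]; ring
  | smul c D _ h => simp only [LinearMap.smul_apply, smul_eq_mul, h]; ring

theorem tangent_zero {ev : analyticAlg E →ₐ[ℝ] F} {hev : KillsZeroGerms ev}
    {D : analyticAlg E →ₗ[ℝ] F} (hD : D ∈ tangent hev) {f : analyticAlg E} (hf : f.1 =ᶠ[𝓝 0] 0) :
    D f = 0 := by
  induction hD using Submodule.span_induction with
  | mem D hD =>
    obtain ⟨w, rfl⟩ := hD
    refine hev _ ?_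
    filter_upwards [hf.eventuallyEq_nhds] with x hx
    change fderiv ℝ f.1 x w = 0
    rw [hx.fderiv_eq]
    simp
  | zero => simp
  | add D₁ D₂ _ _ h₁ h₂ => simp [h₁, h₂]
  | smul c D _ h => simp [h]

theorem evDeriv_comp_pull {ev : analyticAlg E₁ →ₐ[ℝ] F} (hev : KillsZeroGerms ev)
    (l : E₁ →L[ℝ] E₂) (w : E₁) :
    (evDeriv hev w).comp (pull l).toLinearMap = evDeriv (hev.pull l) (l w) := by
  ext f
  refine hev.congr ?_
  filter_upwards [(l.continuous.tendsto' 0 0 (map_zero l)).eventually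
    (eventually_differentiableAt f)]
    with x hx
  change fderiv ℝ (f.1 ∘ l) x w = fderiv ℝ f.1 (l x) (l w)
  rw [fderiv_comp _ hx l.differentiableAt, l.fderiv]
  rfl

theorem tangent_comp_pull {ev : analyticAlg E₁ →ₐ[ℝ] F} {hev : KillsZeroGerms ev}
    (l : E₁ →L[ℝ] E₂) {D : analyticAlg E₁ →ₗ[ℝ] F} (hD : D ∈ tangent hev) :
    D.comp (pull l).toLinearMap ∈ tangent (hev.pull l) := by
  induction hD using Submodule.span_induction with
  | mem D hD =>
    obtain ⟨w, rfl⟩ := hD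
    rw [evDeriv_comp_pull]
    exact Submodule.subset_span ⟨_, rfl⟩
  | zero => rw [LinearMap.zero_comp]; exact Submodule.zero_mem _
  | add D₁ D₂ _ _ h₁ h₂ => rw [LinearMap.add_comp]; exact Submodule.add_mem _ h₁ h₂
  | smul c D _ h => rw [LinearMap.smul_comp]; exact Submodule.smul_mem _ _ h

theorem exists_tangent_lift {ev : analyticAlg E₁ →ₐ[ℝ] F} {hev : KillsZeroGerms ev}
    {l : E₁ →L[ℝ] E₂} (hl : Function.Surjective l) {D : analyticAlg E₂ →ₗ[ℝ] F}
    (hD : D ∈ tangent (hev.pull l)) :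
    ∃ D' ∈ tangent hev, D'.comp (pull l).toLinearMap = D := by
  induction hD using Submodule.span_induction with
  | mem D hD =>
    obtain ⟨w, rfl⟩ := hD
    obtain ⟨w, rfl⟩ := hl w
    exact ⟨_, Submodule.subset_span ⟨w, rfl⟩, evDeriv_comp_pull hev l w⟩
  | zero => exact ⟨0, Submodule.zero_mem _, LinearMap.zero_comp _⟩
  | add D₁ D₂ _ _ h₁ h₂ =>
    obtain ⟨D₁', h₁, rfl⟩ := h₁
    obtain ⟨D₂', h₂, rfl⟩ := h₂
    exact ⟨D₁' + D₂', Submodule.add_mem _ h₁ h₂, LinearMap.add_comp _ _ _⟩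
  | smul c D _ h =>
    obtain ⟨D', h, rfl⟩ := h
    exact ⟨c • D', Submodule.smul_mem _ _ h, LinearMap.smul_comp _ _ _⟩

theorem KillsZeroGerms.compHom {ev : analyticAlg E →ₐ[ℝ] L} (hev : KillsZeroGerms ev)
    (j : L →ₐ[ℝ] F) : KillsZeroGerms (j.comp ev) := by
  intro f hf
  rw [AlgHom.comp_apply, hev f hf, map_zero]

theorem tangent_compHom {ev : analyticAlg E →ₐ[ℝ] L} {hev : KillsZeroGerms ev}
    (j : L →ₐ[ℝ] F) {D : analyticAlg E →ₗ[ℝ] L} (hD : D ∈ tangent hev) :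
    j.toLinearMap.comp D ∈ tangent (hev.compHom j) := by
  induction hD using Submodule.span_induction with
  | mem D hD =>
    obtain ⟨w, rfl⟩ := hD
    exact Submodule.subset_span ⟨w, rfl⟩
  | zero => rw [LinearMap.comp_zero]; exact Submodule.zero_mem _
  | add D₁ D₂ _ _ h₁ h₂ => rw [LinearMap.comp_add]; exact Submodule.add_mem _ h₁ h₂
  | smul c D _ h =>
    have : j.toLinearMap.comp (c • D) = j c • j.toLinearMap.comp D := by
      ext f
      simp
    rw [this]
    exact Submodule.smul_mem _ _ h

end

end

section

variable {E E₁ E₂ : Type} [NormedAddCommGroup E] [NormedSpace ℝ E]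
  [NormedAddCommGroup E₁] [NormedSpace ℝ E₁] [NormedAddCommGroup E₂] [NormedSpace ℝ E₂]
  {F L : Type} [Field F] [Algebra ℝ F] [Field L] [Algebra ℝ L]

/-- If the image of `ev` generates `F`, a quotient of germs which is killed by all the derivations
tangent to the kernel of `ev` is algebraic over `ℝ`. -/
def ConstantsAlgebraicFor {ev : analyticAlg E →ₐ[ℝ] F} (hev : KillsZeroGerms ev) : Prop :=
  (∀ x : F, ∃ a b, ev b ≠ 0 ∧ x = ev a / ev b) →
    ∀ a b, ev b ≠ 0 →
      (∀ D ∈ tangent hev, (∀ f, ev f = 0 → D f = 0) → D a * ev b = ev a * D b) →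
      IsAlgebraic ℝ (ev a / ev b)

/-- The property proved by induction on the dimension: `ConstantsAlgebraicFor` holds for all
homomorphisms from the germs on `E` to a field. -/
def ConstantsAlgebraic (E : Type) [NormedAddCommGroup E] [NormedSpace ℝ E] : Prop :=
  ∀ (F : Type) [Field F] [Algebra ℝ F] (ev : analyticAlg E →ₐ[ℝ] F) (hev : KillsZeroGerms ev),
    ConstantsAlgebraicFor hev

theorem ConstantsAlgebraicFor.of_equiv (e : E₁ ≃L[ℝ] E₂) {ev : analyticAlg E₁ →ₐ[ℝ] F}
    {hev : KillsZeroGerms ev} (h : ConstantsAlgebraicFor (hev.pull (e : E₁ →L[ℝ] E₂))) :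
    ConstantsAlgebraicFor hev := by
  intro hfrac a b hb hD
  have key : ∀ f, ev (pull (e : E₁ →L[ℝ] E₂) (pull (e.symm : E₂ →L[ℝ] E₁) f)) = ev f := by
    intro f
    congr 1
    refine Subtype.ext (funext fun x => ?_)
    change f.1 (e.symm (e x)) = f.1 x
    rw [e.symm_apply_apply]
  have := h ?_ (pull (e.symm : E₂ →L[ℝ] E₁) a)
    (pull (e.symm : E₂ →L[ℝ] E₁) b) ?_ ?_
  · simpa only [AlgHom.comp_apply, key] using this
  · intro x
    obtain ⟨a, b, hb, rfl⟩ := hfrac x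
    refine ⟨pull (e.symm : E₂ →L[ℝ] E₁) a, pull (e.symm : E₂ →L[ℝ] E₁) b, ?_, ?_⟩
    · simpa only [AlgHom.comp_apply, key] using hb
    · simp only [AlgHom.comp_apply, key]
  · simpa only [AlgHom.comp_apply, key] using hb
  · intro D hDt hDk
    simp only [AlgHom.comp_apply, key]
    have h1 := tangent_comp_pull (e.symm : E₂ →L[ℝ] E₁) hDt
    have h2 : (ev.comp (pull (e : E₁ →L[ℝ] E₂))).comp (pull (e.symm : E₂ →L[ℝ] E₁)) = ev :=
      AlgHom.ext key
    have h3 : D.comp (pull (e.symm : E₂ →L[ℝ] E₁)).toLinearMap ∈ tangent hev := by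
      convert h1 using 2; exact h2.symm
    exact hD _ h3 fun f hf => hDk _ ((key f).trans hf)

/-- A derivation over `ev` which kills `E` and the last coordinate is zero. -/
theorem eq_zero_of_division {ev : analyticAlg (E × ℝ) →ₐ[ℝ] F} (z : analyticAlg (E × ℝ))
    (Δ : analyticAlg (E × ℝ) →ₗ[ℝ] F)
    (hΔ : ∀ f g, Δ (f * g) = ev f * Δ g + ev g * Δ f) (hz : Δ z = 0)
    (hπ : ∀ f, Δ (pull (ContinuousLinearMap.fst ℝ E ℝ) f) = 0)
    {f₀ q₀ : analyticAlg (E × ℝ)} (hf₀ : ev f₀ = 0) (hq₀ : ev q₀ ≠ 0) {d : ℕ}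
    {r₀ : ℕ → analyticAlg E}
    (h₀ : Δ (z ^ d) = Δ (q₀ * f₀ + ∑ j ∈ Finset.range d,
      pull (ContinuousLinearMap.fst ℝ E ℝ) (r₀ j) * z ^ j))
    {f q : analyticAlg (E × ℝ)} {r : ℕ → analyticAlg E}
    (hf : Δ f = Δ (q * f₀ + ∑ j ∈ Finset.range d,
      pull (ContinuousLinearMap.fst ℝ E ℝ) (r j) * z ^ j)) : Δ f = 0 := by
  have hzp : ∀ j : ℕ, Δ (z ^ j) = 0 := by
    intro j
    induction j with
    | zero =>
      have := hΔ 1 1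
      simp only [mul_one, map_one, one_mul] at this
      simpa using this
    | succ j ih => rw [pow_succ, hΔ, ih, hz, mul_zero, mul_zero, add_zero]
  have hs : ∀ r : ℕ → analyticAlg E, Δ (∑ j ∈ Finset.range d,
      pull (ContinuousLinearMap.fst ℝ E ℝ) (r j) * z ^ j) = 0 := by
    intro r
    rw [map_sum]
    refine Finset.sum_eq_zero fun j _ => ?_
    rw [hΔ, hzp, hπ, mul_zero, mul_zero, add_zero]
  have hf₀' : Δ f₀ = 0 := by
    rw [hzp, map_add, hs, add_zero, hΔ, hf₀, zero_mul, add_zero] at h₀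
    exact (mul_eq_zero.1 h₀.symm).resolve_left hq₀
  rw [hf, map_add, hs, hΔ, hf₀', hf₀]
  simp

/-- A linear map on the functions satisfying the Leibniz rule over `ev` and killing its kernel
descends to a derivation of the image. -/
theorem exists_derivation_fractionRing {A F : Type} [CommRing A] [Algebra ℝ A] {P : Ideal A}
    [Field F] [Algebra ℝ F] [Algebra (A ⧸ P) F] [IsScalarTower ℝ (A ⧸ P) F]
    (D : A →ₗ[ℝ] F) (hD : ∀ f g, D (f * g) = algebraMap (A ⧸ P) F (Ideal.Quotient.mk P f) * D g +
      algebraMap (A ⧸ P) F (Ideal.Quotient.mk P g) * D f) (hP : ∀ f ∈ P, D f = 0) :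
    ∃ D' : Derivation ℝ (A ⧸ P) F, ∀ f, D' (Ideal.Quotient.mk P f) = D f := by
  let l : (A ⧸ P) →ₗ[ℝ] F := (Submodule.liftQ (P.restrictScalars ℝ) D fun f hf => hP f hf)
  have hl : ∀ f, l (Ideal.Quotient.mk P f) = D f := fun f => rfl
  refine ⟨Derivation.mk' l fun x y => ?_, hl⟩
  obtain ⟨f, rfl⟩ := Ideal.Quotient.mk_surjective x
  obtain ⟨g, rfl⟩ := Ideal.Quotient.mk_surjective y
  rw [← map_mul, hl, hl, hl, hD, Algebra.smul_def, Algebra.smul_def]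

end

/-- The unit factor in a Weierstrass division of `t ^ d` does not vanish. -/
theorem eq_zero_of_sum_eq_pow_mul {d : ℕ} {r : ℕ → ℝ} {k : ℝ → ℝ} (hk : ContinuousAt k 0)
    (h : ∀ᶠ t in 𝓝[≠] (0 : ℝ), ∑ j ∈ Finset.range d, r j * t ^ j = t ^ d * k t) : k 0 = 0 := by
  induction d generalizing r with
  | zero =>
    have : Tendsto k (𝓝[≠] 0) (𝓝 0) :=
      tendsto_const_nhds.congr' (h.mono fun t ht => by simpa using ht)
    exact tendsto_nhds_unique (hk.tendsto.mono_left nhdsWithin_le_nhds) this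
  | succ d ih =>
    have hr0 : r 0 = 0 := by
      have h1 : Tendsto (fun t : ℝ => ∑ j ∈ Finset.range (d + 1), r j * t ^ j)
          (𝓝[≠] 0) (𝓝 (r 0)) := by
        refine Tendsto.mono_left (Continuous.tendsto' (by fun_prop) _ _ ?_) nhdsWithin_le_nhds
        simp [Finset.sum_range_succ']
      have h2 : Tendsto (fun t : ℝ => t ^ (d + 1) * k t) (𝓝[≠] 0) (𝓝 (0 ^ (d + 1) * k 0)) :=
        ((continuous_pow (d + 1)).continuousAt.mul hk).tendsto.mono_left nhdsWithin_le_nhds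
      have := tendsto_nhds_unique h1 (h2.congr' (h.mono fun t ht => ht.symm))
      simpa using this
    refine ih (r := fun j => r (j + 1)) ?_
    filter_upwards [h, self_mem_nhdsWithin] with t ht ht0
    rw [Finset.sum_range_succ', hr0, zero_mul, add_zero] at ht
    apply mul_left_cancel₀ (show t ≠ 0 from ht0)
    rw [Finset.mul_sum]
    refine (Finset.sum_congr rfl fun j _ => ?_).trans (ht.trans ?_) <;> ring

theorem exists_weierstrass {E : Type} [NormedAddCommGroup E] [NormedSpace ℝ E]
    [FiniteDimensional ℝ E] {g : E × ℝ → ℝ} (hg : AnalyticAt ℝ g 0)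
    (hreg : ¬ ∀ᶠ t in 𝓝 (0 : ℝ), g (0, t) = 0) :
    ∃ d : ℕ, (∀ f : E × ℝ → ℝ, AnalyticAt ℝ f 0 →
      ∃ (q : E × ℝ → ℝ) (r : ℕ → E → ℝ), AnalyticAt ℝ q 0 ∧ (∀ j, AnalyticAt ℝ (r j) 0) ∧
        ∀ᶠ x : E × ℝ in 𝓝 0, f x = q x * g x + ∑ j ∈ Finset.range d, r j x.1 * x.2 ^ j) ∧
      ∃ (q : E × ℝ → ℝ) (r : ℕ → E → ℝ), AnalyticAt ℝ q 0 ∧ q 0 ≠ 0 ∧ (∀ j, AnalyticAt ℝ (r j) 0) ∧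
        ∀ᶠ x : E × ℝ in 𝓝 0, x.2 ^ d = q x * g x + ∑ j ∈ Finset.range d, r j x.1 * x.2 ^ j := by
  have hg' : AnalyticAt ℝ (fun t : ℝ => g (0, t)) 0 :=
    AnalyticAt.fun_comp (f := fun t : ℝ => ((0 : E), t)) hg (analyticAt_const.prod analyticAt_id)
  obtain ⟨d, h, hh, hh0, hgh⟩ := hg'.exists_eventuallyEq_pow_smul_nonzero_iff.2 hreg
  simp only [sub_zero, smul_eq_mul] at hgh
  have hdiv := fun f hf => weierstrass_division (f := f) hg hh hh0 hgh hf
  refine ⟨d, hdiv, ?_⟩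
  obtain ⟨q, r, hq, hr, hqr⟩ := hdiv (fun x => x.2 ^ d) (analyticAt_snd.pow d)
  refine ⟨q, r, hq, fun hq0 => ?_, hr, hqr⟩
  have hl : Tendsto (fun t : ℝ => ((0 : E), t)) (𝓝 0) (𝓝 0) :=
    Continuous.tendsto' (by fun_prop) _ _ rfl
  have hqc : ContinuousAt (fun t : ℝ => q (0, t)) 0 :=
    ContinuousAt.comp (f := fun t : ℝ => ((0 : E), t)) hq.continuousAt (by fun_prop)
  have := eq_zero_of_sum_eq_pow_mul (d := d) (r := fun j => r j 0)
    (k := fun t => 1 - q (0, t) * h t)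
    (continuousAt_const.sub (hqc.mul hh.continuousAt)) ?_
  · have h00 : q ((0 : E), (0 : ℝ)) = 0 := hq0
    simp [h00] at this
  · refine Filter.Eventually.filter_mono nhdsWithin_le_nhds ?_
    filter_upwards [hl.eventually hqr, hgh] with t h1 h2
    simp only [h2] at h1
    linear_combination -h1

/-- The subfield generated by the image of a homomorphism to a field. -/
theorem exists_fraction_subfield {A F : Type} [CommRing A] [Algebra ℝ A] [Field F] [Algebra ℝ F]
    (ev : A →ₐ[ℝ] F) : ∃ (L : Type) (_ : Field L) (_ : Algebra ℝ L) (j : L →ₐ[ℝ] F)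
      (evL : A →ₐ[ℝ] L), j.comp evL = ev ∧ (∀ x : L, ∃ a b, evL b ≠ 0 ∧ x = evL a / evL b) ∧
      ∀ D : A →ₗ[ℝ] L, (∀ f g, D (f * g) = evL f * D g + evL g * D f) →
        (∀ f, evL f = 0 → D f = 0) → ∃ δ : Derivation ℝ L L, ∀ f, δ (evL f) = D f := by
  let P : Ideal A := RingHom.ker ev
  have : P.IsPrime := RingHom.ker_isPrime ev
  let jS : A ⧸ P →ₐ[ℝ] F := Ideal.Quotient.liftₐ P ev fun _ h => h
  have hjS : Function.Injective jS := by
    rw [injective_iff_map_eq_zero]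
    intro x hx
    obtain ⟨f, rfl⟩ := Ideal.Quotient.mk_surjective x
    exact Ideal.Quotient.eq_zero_iff_mem.2 hx
  have hj : ∀ s : A ⧸ P, IsFractionRing.liftAlgHom (K := FractionRing (A ⧸ P)) (g := jS) hjS
    (algebraMap (A ⧸ P) (FractionRing (A ⧸ P)) s) = jS s :=
    fun s => IsFractionRing.lift_algebraMap hjS s
  refine ⟨FractionRing (A ⧸ P), inferInstance, inferInstance,
    IsFractionRing.liftAlgHom (g := jS) hjS,
    (IsScalarTower.toAlgHom ℝ (A ⧸ P) (FractionRing (A ⧸ P))).comp (Ideal.Quotient.mkₐ ℝ P),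
    ?_, ?_, ?_⟩
  · ext f
    exact hj _
  · intro x
    obtain ⟨s, t, ht, rfl⟩ := IsFractionRing.div_surjective (A := A ⧸ P) x
    obtain ⟨a, rfl⟩ := Ideal.Quotient.mk_surjective s
    obtain ⟨b, rfl⟩ := Ideal.Quotient.mk_surjective t
    refine ⟨a, b, fun h0 => ?_, rfl⟩
    exact nonZeroDivisors.ne_zero ht
      (IsFractionRing.injective (A ⧸ P) (FractionRing (A ⧸ P)) (h0.trans (map_zero _).symm))
  · intro D hD hDk
    obtain ⟨δS, hδS⟩ := exists_derivation_fractionRing (P := P) (F := FractionRing (A ⧸ P)) D hD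
      (fun f hf => hDk f ((congrArg (algebraMap (A ⧸ P) (FractionRing (A ⧸ P)))
        (Ideal.Quotient.eq_zero_iff_mem.2 hf)).trans (map_zero _)))
    have : Algebra.FormallyEtale (A ⧸ P) (FractionRing (A ⧸ P)) :=
      Algebra.FormallyEtale.of_isLocalization (nonZeroDivisors (A ⧸ P))
    obtain ⟨δL, hδL⟩ := δS.exists_extension (T := FractionRing (A ⧸ P))
    exact ⟨δL, fun f => (hδL _).trans (hδS f)⟩

theorem ConstantsAlgebraic.of_regular {E : Type} [NormedAddCommGroup E] [NormedSpace ℝ E]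
    [FiniteDimensional ℝ E] (h : ConstantsAlgebraic E) {F : Type} [Field F] [Algebra ℝ F]
    {ev : analyticAlg (E × ℝ) →ₐ[ℝ] F} (hev : KillsZeroGerms ev)
    (hfrac : ∀ x : F, ∃ a b, ev b ≠ 0 ∧ x = ev a / ev b) {f₀ : analyticAlg (E × ℝ)}
    (hf₀ : ev f₀ = 0) (hreg : ¬ ∀ᶠ t in 𝓝 (0 : ℝ), f₀.1 (0, t) = 0) (a b : analyticAlg (E × ℝ))
    (hb : ev b ≠ 0)
    (hD : ∀ D ∈ tangent hev, (∀ f, ev f = 0 → D f = 0) → D a * ev b = ev a * D b) :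
    IsAlgebraic ℝ (ev a / ev b) := by
  obtain ⟨d, hdiv, q₀, r₀, hq₀, hq₀0, hr₀, h₀⟩ := exists_weierstrass f₀.2 hreg
  let π : analyticAlg E →ₐ[ℝ] analyticAlg (E × ℝ) := pull (ContinuousLinearMap.fst ℝ E ℝ)
  let z : analyticAlg (E × ℝ) := ⟨fun x => x.2, analyticAt_snd⟩
  let Q₀ : analyticAlg (E × ℝ) := ⟨q₀, hq₀⟩
  let R₀ : ℕ → analyticAlg E := fun j => ⟨r₀ j, hr₀ j⟩
  have hsum : ∀ (r : ℕ → analyticAlg E) (x : E × ℝ),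
      (∑ j ∈ Finset.range d, π (r j) * z ^ j : analyticAlg (E × ℝ)).1 x =
        ∑ j ∈ Finset.range d, (r j).1 x.1 * x.2 ^ j := by
    intro r x
    rw [← Subalgebra.coe_val, map_sum, Finset.sum_apply]
    rfl
  have hdiv' : ∀ f : analyticAlg (E × ℝ), ∃ (q : analyticAlg (E × ℝ)) (r : ℕ → analyticAlg E),
      f.1 =ᶠ[𝓝 0] (q * f₀ + ∑ j ∈ Finset.range d, π (r j) * z ^ j : analyticAlg (E × ℝ)).1 := by
    intro f
    obtain ⟨q, r, hq, hr, hqr⟩ := hdiv f.1 f.2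
    refine ⟨⟨q, hq⟩, fun j => ⟨r j, hr j⟩, ?_⟩
    filter_upwards [hqr] with x hx
    rw [hx]
    exact congrArg (q x * f₀.1 x + ·) (hsum (fun j => ⟨r j, hr j⟩) x).symm
  have h₀' : (z ^ d : analyticAlg (E × ℝ)).1 =ᶠ[𝓝 0]
      (Q₀ * f₀ + ∑ j ∈ Finset.range d, π (R₀ j) * z ^ j : analyticAlg (E × ℝ)).1 := by
    filter_upwards [h₀] with x hx
    exact hx.trans (congrArg (q₀ x * f₀.1 x + ·) (hsum R₀ x).symm)
  have hQ₀ : ev Q₀ ≠ 0 := hev.apply_ne_zero hq₀0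
  -- the base field
  obtain ⟨L, _, _, j, evL, hjev, hfracL, hext⟩ := exists_fraction_subfield (ev.comp π)
  let ev' : analyticAlg E →ₐ[ℝ] F := ev.comp π
  let : Algebra L F := j.toRingHom.toAlgebra
  have : IsScalarTower ℝ L F := IsScalarTower.of_algebraMap_eq fun c => (j.commutes c).symm
  have hjev' : ∀ f, algebraMap L F (evL f) = ev (π f) := fun f => DFunLike.congr_fun hjev f
  have hevL : KillsZeroGerms evL := by
    intro f hf
    have : j (evL f) = 0 := (hjev' f).trans (hev.pull _ f hf)
    exact j.toRingHom.injective (this.trans (map_zero _).symm)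
  -- `F` is algebraic over `L`
  have hθ : IsIntegral L (ev z) := by
    refine ⟨Polynomial.X ^ d - ∑ j ∈ Finset.range d, Polynomial.C (evL (R₀ j)) * Polynomial.X ^ j,
      ?_, ?_⟩
    · apply Polynomial.monic_X_pow_sub
      refine (Polynomial.degree_sum_le _ _).trans_lt ?_
      rw [Finset.sup_lt_iff (WithBot.bot_lt_coe _)]
      intro j hj
      exact (Polynomial.degree_C_mul_X_pow_le _ _).trans_lt
        (by exact_mod_cast Finset.mem_range.1 hj)
    · have := hev.congr h₀'
      simp only [map_pow, map_add, map_mul, hf₀, mul_zero, zero_add, map_sum] at this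
      simp only [Polynomial.eval₂_sub, Polynomial.eval₂_finsetSum, Polynomial.eval₂_mul,
        Polynomial.eval₂_X_pow, Polynomial.eval₂_C, hjev', this, sub_self]
  have hIntegral : ∀ f, IsIntegral L (ev f) := by
    intro f
    obtain ⟨q, r, hqr⟩ := hdiv' f
    have := hev.congr hqr
    simp only [map_pow, map_add, map_mul, hf₀, mul_zero, zero_add, map_sum] at this
    rw [this]
    refine IsIntegral.sum _ fun j _ => IsIntegral.mul ?_ (hθ.pow j)
    rw [← hjev']
    exact isIntegral_algebraMap
  have : Algebra.IsAlgebraic L F := by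
    refine ⟨fun x => ?_⟩
    obtain ⟨a, b, -, rfl⟩ := hfrac x
    rw [div_eq_mul_inv]
    exact ((hIntegral a).mul (hIntegral b).inv).isAlgebraic
  have : CharZero L := charZero_of_injective_algebraMap (algebraMap ℝ L).injective
  have : Algebra.FormallyEtale L F := Algebra.FormallyEtale.of_isSeparable L F
  set u := ev a / ev b with hu
  have hui : IsIntegral L u := Algebra.IsIntegral.isIntegral u
  refine isAlgebraic_of_coeff_minpoly hui fun i => ?_
  obtain ⟨a', b', hb', hab'⟩ := hfracL ((minpoly L u).coeff i)
  rw [hab']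
  refine h L evL hevL hfracL a' b' hb' fun D' hD' hD'k => ?_
  -- extend the derivation
  obtain ⟨δL, hδL'⟩ := hext D' (tangent_leibniz hD') hD'k
  let D₁ : Derivation ℝ L F := (Algebra.linearMap L F).compDer δL
  obtain ⟨δ, hδ⟩ := D₁.exists_extension (T := F)
  have hδ' : ∀ c, δ (algebraMap L F c) = algebraMap L F (δL c) := hδ
  have hδev : ∀ f, δ (ev (π f)) = j (D' f) := by
    intro f
    rw [← hjev', hδ', hδL']
    rfl
  -- lift the derivation to the functions
  have hjD : j.toLinearMap.comp D' ∈ tangent (hev.pull (ContinuousLinearMap.fst ℝ E ℝ)) := by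
    have h1 := tangent_compHom j hD'
    convert h1 using 2; exact hjev.symm
  obtain ⟨D₂, hD₂, hD₂π⟩ := exists_tangent_lift (fun x => ⟨(x, 0), rfl⟩) hjD
  let V := evDeriv hev ((0 : E), (1 : ℝ))
  have hVπ : ∀ f, V (π f) = 0 := by
    intro f
    have := DFunLike.congr_fun
      (evDeriv_comp_pull hev (ContinuousLinearMap.fst ℝ E ℝ) ((0 : E), (1 : ℝ))) f
    refine this.trans (hev _ (Eventually.of_forall fun x => ?_))
    change fderiv ℝ f.1 x.1 0 = 0
    exact map_zero _
  have hVz : V z = 1 := by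
    have : dirDeriv ((0 : E), (1 : ℝ)) z = 1 := by
      refine Subtype.ext (funext fun x => ?_)
      change fderiv ℝ (fun x : E × ℝ => x.2) x (0, 1) = 1
      rw [fderiv_snd]
      rfl
    change ev (dirDeriv _ z) = 1
    rw [this, map_one]
  let D₃ := D₂ + (δ (ev z) - D₂ z) • V
  have hD₃ : D₃ ∈ tangent hev :=
    Submodule.add_mem _ hD₂ (Submodule.smul_mem _ _ (Submodule.subset_span ⟨_, rfl⟩))
  have hD₃δ : ∀ f, D₃ f = δ (ev f) := by
    let Δ : analyticAlg (E × ℝ) →ₗ[ℝ] F := D₃ - (δ : F →ₗ[ℝ] F).comp ev.toLinearMap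
    have hΔd : ∀ f, Δ f = D₃ f - δ (ev f) := fun f => rfl
    have hΔc : ∀ {f g : analyticAlg (E × ℝ)}, f.1 =ᶠ[𝓝 0] g.1 → Δ f = Δ g := by
      intro f g hfg
      have h1 : (f - g).1 =ᶠ[𝓝 0] 0 := by
        filter_upwards [hfg] with x hx
        exact sub_eq_zero.2 hx
      rw [← sub_eq_zero, ← map_sub, hΔd, tangent_zero hD₃ h1, hev _ h1, map_zero, sub_zero]
    intro f
    obtain ⟨q, r, hqr⟩ := hdiv' f
    have := eq_zero_of_division z Δ ?_ ?_ ?_ hf₀ hQ₀ (hΔc h₀') (hΔc hqr)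
    · exact sub_eq_zero.1 this
    · intro f g
      rw [hΔd, hΔd, hΔd, tangent_leibniz hD₃, map_mul, Derivation.leibniz, smul_eq_mul, smul_eq_mul]
      ring
    · rw [hΔd]
      simp [D₃, hVz]
    · intro f
      rw [hΔd]
      have h1 : D₂ (π f) = j (D' f) := DFunLike.congr_fun hD₂π f
      change D₂ (π f) + (δ (ev z) - D₂ z) * V (π f) - δ (ev (π f)) = 0
      rw [hVπ, h1, hδev]
      ring
  have hδu : δ u = 0 := by
    have h1 := hD D₃ hD₃ fun f hf => by rw [hD₃δ, hf, map_zero]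
    rw [hD₃δ, hD₃δ] at h1
    have h2 : u * ev b = ev a := div_mul_cancel₀ _ hb
    have h3 := congrArg δ h2
    rw [Derivation.leibniz, smul_eq_mul, smul_eq_mul] at h3
    have h4 : ev b * ev b * δ u = 0 := by
      linear_combination ev b * h3 + h1 - δ (ev b) * h2
    exact (mul_eq_zero.1 h4).resolve_left (mul_ne_zero hb hb)
  have hc := δL.apply_coeff_minpoly_eq_zero δ hδ' hui hδu i
  rw [hab'] at hc
  have h2 : evL a' / evL b' * evL b' = evL a' := div_mul_cancel₀ _ hb'
  have h3 := congrArg δL h2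
  rw [Derivation.leibniz, hc, smul_zero, add_zero, smul_eq_mul, hδL', hδL'] at h3
  rw [← h3]
  linear_combination h2 * D' b'

section

variable {E : Type} [NormedAddCommGroup E] [NormedSpace ℝ E] [FiniteDimensional ℝ E]

theorem eventually_eq_const_mul {a b : analyticAlg E} (hb : ¬ ∀ᶠ x in 𝓝 0, b.1 x = 0)
    (hab : ∀ w, ∀ᶠ x in 𝓝 0, fderiv ℝ a.1 x w * b.1 x = a.1 x * fderiv ℝ b.1 x w) :
    ∃ c : ℝ, ∀ᶠ x in 𝓝 0, a.1 x = c * b.1 x := by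
  let v := Module.finBasis ℝ E
  have h1 : ∀ᶠ x in 𝓝 (0 : E), ∀ i, fderiv ℝ a.1 x (v i) * b.1 x = a.1 x * fderiv ℝ b.1 x (v i) :=
    eventually_all.2 fun i => hab (v i)
  obtain ⟨r, hr, hball⟩ := Metric.eventually_nhds_iff_ball.1
    (h1.and (a.2.eventually_analyticAt.and b.2.eventually_analyticAt))
  obtain ⟨x₀, hx₀, hbx₀⟩ : ∃ x₀ ∈ Metric.ball (0 : E) r, b.1 x₀ ≠ 0 := by
    by_contra! hcon
    exact hb (Metric.eventually_nhds_iff_ball.2 ⟨r, hr, hcon⟩)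
  have h2 : ∀ᶠ x in 𝓝 x₀, x ∈ Metric.ball (0 : E) r ∧ b.1 x ≠ 0 :=
    (Metric.isOpen_ball.eventually_mem hx₀).and
      ((hball x₀ hx₀).2.2.continuousAt.eventually_ne hbx₀)
  obtain ⟨s, hs, hballs⟩ := Metric.eventually_nhds_iff_ball.1 h2
  have hder : ∀ x ∈ Metric.ball x₀ s, HasFDerivAt (fun x => a.1 x / b.1 x) (0 : E →L[ℝ] ℝ) x := by
    intro x hx
    obtain ⟨hxr, hbx⟩ := hballs x hx
    obtain ⟨hi, ha, hb'⟩ := hball x hxr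
    have hlin : b.1 x • fderiv ℝ a.1 x = a.1 x • fderiv ℝ b.1 x := by
      refine ContinuousLinearMap.coe_injective (v.ext fun i => ?_)
      have := hi i
      simp only [ContinuousLinearMap.toLinearMap_smul, LinearMap.smul_apply,
        ContinuousLinearMap.coe_coe, smul_eq_mul]
      linarith
    have := ha.differentiableAt.hasFDerivAt.fun_mul
      ((hasDerivAt_inv hbx).comp_hasFDerivAt x hb'.differentiableAt.hasFDerivAt)
    simp only [div_eq_mul_inv]
    refine this.congr_fderiv ?_
    have h3 := congrArg (((b.1 x) ^ 2)⁻¹ • ·) hlin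
    simp only [smul_smul] at h3
    have h4 : ((b.1 x) ^ 2)⁻¹ * b.1 x = (b.1 x)⁻¹ := by field_simp
    rw [h4] at h3
    rw [Function.comp_apply, h3, smul_smul, ← add_smul]
    ring_nf
    rw [zero_smul]
  have hconst : ∀ x ∈ Metric.ball x₀ s, a.1 x / b.1 x = a.1 x₀ / b.1 x₀ := by
    intro x hx
    exact (convex_ball x₀ s).is_const_of_fderivWithin_eq_zero (𝕜 := ℝ)
      (fun y hy => (hder y hy).differentiableAt.differentiableWithinAt)
      (fun y hy => by
        rw [fderivWithin_of_isOpen Metric.isOpen_ball hy]; exact (hder y hy).fderiv)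
      hx (Metric.mem_ball_self hs)
  refine ⟨a.1 x₀ / b.1 x₀, ?_⟩
  have hana : AnalyticOnNhd ℝ (fun x => a.1 x - a.1 x₀ / b.1 x₀ * b.1 x) (Metric.ball 0 r) :=
    fun x hx => ((hball x hx).2.1).fun_sub (analyticAt_const.fun_mul (hball x hx).2.2)
  have := hana.eqOn_zero_of_preconnected_of_eventuallyEq_zero
    (convex_ball (0 : E) r).isPreconnected hx₀
    (by
      filter_upwards [Metric.ball_mem_nhds x₀ hs] with x hx
      have := hconst x hx
      have hbx := (hballs x hx).2
      simp only [Pi.zero_apply]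
      rw [← this, div_mul_cancel₀ _ hbx, sub_self])
  filter_upwards [Metric.ball_mem_nhds (0 : E) hr] with x hx
  exact sub_eq_zero.1 (this hx)

end

theorem exists_regular_direction {E : Type} [NormedAddCommGroup E]
    [NormedSpace ℝ E] {f : E → ℝ} (hf : AnalyticAt ℝ f 0)
    (h : ¬ ∀ᶠ x in 𝓝 0, f x = 0) (h0 : f 0 = 0) :
    ∃ y : E, y ≠ 0 ∧ ¬ ∀ᶠ t in 𝓝 (0 : ℝ), f (t • y) = 0 := by
  obtain ⟨r, hr, hball⟩ := Metric.eventually_nhds_iff_ball.1 hf.eventually_analyticAt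
  obtain ⟨y, hy, hfy⟩ : ∃ y ∈ Metric.ball (0 : E) r, f y ≠ 0 := by
    by_contra! hcon
    exact h (Metric.eventually_nhds_iff_ball.2 ⟨r, hr, hcon⟩)
  refine ⟨y, fun hy0 => hfy (hy0 ▸ h0), fun hcon => hfy ?_⟩
  let l : ℝ →L[ℝ] E := ContinuousLinearMap.toSpanSingleton ℝ y
  have hs : Convex ℝ (l ⁻¹' Metric.ball 0 r) :=
    (convex_ball (0 : E) r).linear_preimage l.toLinearMap
  have hana : AnalyticOnNhd ℝ (fun t : ℝ => f (l t)) (l ⁻¹' Metric.ball 0 r) :=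
    fun t ht => (hball _ ht).fun_comp (l.analyticAt t)
  have := hana.eqOn_zero_of_preconnected_of_eventuallyEq_zero hs.isPreconnected
    (z₀ := 0) (by simp [hr]) hcon
  have h1 := this (x := 1) (by simpa [l] using hy)
  simpa [l] using h1

theorem constantsAlgebraic (d : ℕ) : ∀ (E : Type) [NormedAddCommGroup E] [NormedSpace ℝ E]
    [FiniteDimensional ℝ E], Module.finrank ℝ E = d → ConstantsAlgebraic E := by
  induction d with
  | zero => ?_
  | succ d ih => ?_
  all_goals
    intro E _ _ _ hE F _ _ ev hev hfrac a b hb hD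
    by_cases hker : ∀ f, ev f = 0 → ∀ᶠ x in 𝓝 0, f.1 x = 0
    · have hb' : ¬ ∀ᶠ x in 𝓝 0, b.1 x = 0 := fun h => hb (hev b h)
      obtain ⟨c, hc⟩ := eventually_eq_const_mul (a := a) hb' fun w => by
        have h1 := hD (evDeriv hev w) (Submodule.subset_span ⟨w, rfl⟩) fun f hf =>
          tangent_zero (Submodule.subset_span ⟨w, rfl⟩) (hker f hf)
        have h2 := hker (dirDeriv w a * b - a * dirDeriv w b)
          (by rw [map_sub, map_mul, map_mul, sub_eq_zero]; exact h1)
        filter_upwards [h2] with x hx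
        exact sub_eq_zero.1 hx
      have : ev a = ev (algebraMap ℝ _ c * b) := hev.congr hc
      rw [this, map_mul, mul_div_cancel_right₀ _ hb, AlgHom.commutes]
      exact isAlgebraic_algebraMap c
    push Not at hker
    obtain ⟨f₀, hf₀, hne⟩ := hker
    have hf₀0 : f₀.1 0 = 0 := by
      by_contra h
      exact hev.apply_ne_zero h hf₀
    obtain ⟨y, hy, hreg⟩ := exists_regular_direction f₀.2 (by simpa using hne) hf₀0
  · have := Module.finrank_zero_iff.1 hE
    exact absurd (Subsingleton.elim y 0) hy
  · let e₀ : E ≃L[ℝ] (Fin d → ℝ) × ℝ := ContinuousLinearEquiv.ofFinrankEq (by simp [hE])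
    obtain ⟨A, hA⟩ := SeparatingDual.exists_continuousLinearEquiv_apply_eq (R := ℝ) hy
      (y := e₀.symm (0, 1)) (by simp)
    let e := A.trans e₀
    have hey : ∀ t : ℝ, e.symm (0, t) = t • y := by
      intro t
      rw [ContinuousLinearEquiv.symm_apply_eq, map_smul]
      simp [e, hA]
    have hinv : ev.comp (pull (e : E →L[ℝ] (Fin d → ℝ) × ℝ))
        (pull (e.symm : (Fin d → ℝ) × ℝ →L[ℝ] E) f₀) = 0 := by
      rw [← hf₀]
      refine hev.congr (Eventually.of_forall fun x => ?_)
      change f₀.1 (e.symm (e x)) = f₀.1 x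
      rw [e.symm_apply_apply]
    refine ConstantsAlgebraicFor.of_equiv e (hev := hev) ?_ hfrac a b hb hD
    intro hfrac' a' b' hb' hD'
    refine (ih (Fin d → ℝ) (by simp)).of_regular (hev.pull _) hfrac' hinv ?_ a' b' hb' hD'
    convert hreg using 4 with t
    exact congrArg f₀.1 (hey t)

section

variable {R : Type} [CommRing R] {n p : ℕ}

/-- The `p × p` minor of the matrix with rows `M i` given by the indices `ι`. -/
noncomputable def minor (M : Fin n → Fin p → R) (ι : Fin p → Fin n) : R :=
  Matrix.det fun j k : Fin p => M (ι k) j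

/-- The `(p+1) × (p+1)` minor of the matrix with an additional column `2 X`. -/
noncomputable def borderedMinor (M : Fin n → Fin p → R) (X : Fin n → R)
    (ι : Fin (p + 1) → Fin n) : R :=
  Matrix.det fun j k : Fin (p + 1) => if h : (j : ℕ) < p then M (ι k) ⟨j, h⟩ else 2 * X (ι k)

theorem map_minor {R' : Type} [CommRing R'] (f : R →+* R') (M : Fin n → Fin p → R)
    (ι : Fin p → Fin n) : f (minor M ι) = minor (fun i j => f (M i j)) ι :=
  (RingHom.map_det f _).trans rfl

theorem map_borderedMinor {R' : Type} [CommRing R'] (f : R →+* R') (M : Fin n → Fin p → R)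
    (X : Fin n → R) (ι : Fin (p + 1) → Fin n) :
    f (borderedMinor M X ι) = borderedMinor (fun i j => f (M i j)) (fun i => f (X i)) ι := by
  refine (RingHom.map_det f _).trans (congrArg Matrix.det (funext fun j => funext fun k => ?_))
  change f (if h : (j : ℕ) < p then M (ι k) ⟨j, h⟩ else 2 * X (ι k)) = _
  split_ifs
  · rfl
  · rw [map_mul, map_ofNat]

theorem borderedMinor_eq_zero {M : Fin n → Fin p → R} {X : Fin n → R}
    (h : ∀ ι, StrictMono ι → borderedMinor M X ι = 0) (ι : Fin (p + 1) → Fin n) :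
    borderedMinor M X ι = 0 := by
  by_cases hι : Function.Injective ι
  · have h1 : StrictMono (ι ∘ Tuple.sort ι) :=
      (Tuple.monotone_sort ι).strictMono_of_injective (hι.comp (Tuple.sort ι).injective)
    have h2 := h _ h1
    have h3 := Matrix.det_permute' (Tuple.sort ι) (fun j k : Fin (p + 1) =>
      if h : (j : ℕ) < p then M (ι k) ⟨j, h⟩ else 2 * X (ι k))
    have h4 : ((Equiv.Perm.sign (Tuple.sort ι) : ℤ) : R) * borderedMinor M X ι = 0 := by
      rw [← h2]
      exact h3.symm
    rcases Int.units_eq_one_or (Equiv.Perm.sign (Tuple.sort ι)) with hs | hs <;>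
      simpa [hs] using h4
  · obtain ⟨k, l, hkl, hne⟩ := Function.not_injective_iff.1 hι
    refine Matrix.det_zero_of_column_eq hne fun j => ?_
    rw [hkl]

theorem exists_multipliers {F : Type} [Field F] [CharZero F] {M : Fin n → Fin p → F}
    {X : Fin n → F} {ι : Fin p → Fin n} (hι : minor M ι ≠ 0)
    (h : ∀ κ, borderedMinor M X κ = 0) : ∃ c : Fin p → F, ∀ i, X i = ∑ j, c j * M i j := by
  set N : Matrix (Fin p) (Fin p) F := fun j k => M (ι k) j with hN
  have key : ∀ i, ∃ c : Fin p → F, Matrix.vecMul c N = X ∘ ι ∧ X i = ∑ j, c j * M i j := by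
    intro i
    obtain ⟨v, hv, hv0⟩ := Matrix.exists_vecMul_eq_zero_iff.2 (h (Fin.snoc ι i))
    have h1 : ∀ k, ∑ j : Fin p, v j.castSucc * M ((Fin.snoc ι i : Fin (p + 1) → Fin n) k) j +
        v (Fin.last p) * (2 * X ((Fin.snoc ι i : Fin (p + 1) → Fin n) k)) = 0 := by
      intro k
      have := (Fin.sum_univ_castSucc _).symm.trans (congrFun hv0 k)
      simpa using this
    have h2 : ∀ k, ∑ j : Fin p, v j.castSucc * M (ι k) j + v (Fin.last p) * (2 * X (ι k)) = 0 := by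
      intro k
      simpa using h1 k.castSucc
    have h3 : ∑ j : Fin p, v j.castSucc * M i j + v (Fin.last p) * (2 * X i) = 0 := by
      simpa using h1 (Fin.last p)
    have hl : v (Fin.last p) ≠ 0 := by
      intro hl
      refine hι (Matrix.exists_vecMul_eq_zero_iff.1 ⟨fun j => v j.castSucc, ?_, ?_⟩)
      · intro h0
        refine hv (funext fun j => ?_)
        refine Fin.lastCases hl (fun j => congrFun h0 j) j
      · funext k
        have := h2 k
        rw [hl, zero_mul, add_zero] at this
        exact this
    have hdiv : ∀ i', ∑ j : Fin p, v j.castSucc * M i' j + v (Fin.last p) * (2 * X i') = 0 →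
        ∑ j, -(v j.castSucc) / (2 * v (Fin.last p)) * M i' j = X i' := by
      intro i' hi
      have : ∀ j, -(v j.castSucc) / (2 * v (Fin.last p)) * M i' j =
          -(2 * v (Fin.last p))⁻¹ * (v j.castSucc * M i' j) := fun j => by ring
      simp only [this]
      rw [← Finset.mul_sum, eq_neg_of_add_eq_zero_left hi]
      field_simp
    exact ⟨fun j => -(v j.castSucc) / (2 * v (Fin.last p)), funext fun k => hdiv _ (h2 k),
      (hdiv _ h3).symm⟩
  choose c hc hX using key
  have hu : IsUnit N := (Matrix.isUnit_iff_isUnit_det N).2 (isUnit_iff_ne_zero.2 hι)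
  by_cases hn : Nonempty (Fin n)
  · obtain ⟨i₀⟩ := hn
    refine ⟨c i₀, fun i => ?_⟩
    have : c i₀ = c i := Matrix.vecMul_injective_of_isUnit hu ((hc i₀).trans (hc i).symm)
    rw [this]
    exact hX i
  · exact ⟨0, fun i => absurd ⟨i⟩ hn⟩

end

section

variable {n p : ℕ}

/-- The coordinates of a map which is analytic at the origin. -/
def coordGerm {φ : EuclideanSpace ℝ (Fin n) → EuclideanSpace ℝ (Fin p)} (hφ : AnalyticAt ℝ φ 0)
    (j : Fin p) : analyticAlg (EuclideanSpace ℝ (Fin n)) :=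
  ⟨fun x => φ x j, ((EuclideanSpace.proj (𝕜 := ℝ) j).analyticAt _).fun_comp hφ⟩

/-- The coordinate functions. -/
def varGerm (i : Fin n) : analyticAlg (EuclideanSpace ℝ (Fin n)) :=
  ⟨fun x => x i, (EuclideanSpace.proj (𝕜 := ℝ) i).analyticAt _⟩

/-- The square of the norm. -/
noncomputable def rhoGerm : analyticAlg (EuclideanSpace ℝ (Fin n)) := ∑ i, varGerm i ^ 2

theorem sum_apply_analyticAlg {E κ : Type} [NormedAddCommGroup E] [NormedSpace ℝ E] (s : Finset κ)
    (f : κ → analyticAlg E) (x : E) : (∑ i ∈ s, f i).1 x = ∑ i ∈ s, (f i).1 x := by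
  simp [Finset.sum_apply]

theorem rhoGerm_apply (x : EuclideanSpace ℝ (Fin n)) : rhoGerm.1 x = ‖x‖ ^ 2 := by
  rw [rhoGerm, sum_apply_analyticAlg, EuclideanSpace.norm_sq_eq]
  refine Finset.sum_congr rfl fun i _ => ?_
  change x i ^ 2 = _
  rw [Real.norm_eq_abs, sq_abs]

/-- The partial derivatives of the coordinates. -/
noncomputable def jacGerm {φ : EuclideanSpace ℝ (Fin n) → EuclideanSpace ℝ (Fin p)}
    (hφ : AnalyticAt ℝ φ 0) (i : Fin n) (j : Fin p) : analyticAlg (EuclideanSpace ℝ (Fin n)) :=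
  dirDeriv (EuclideanSpace.single i 1) (coordGerm hφ j)

theorem jacGerm_apply {φ : EuclideanSpace ℝ (Fin n) → EuclideanSpace ℝ (Fin p)}
    (hφ : AnalyticAt ℝ φ 0) {x : EuclideanSpace ℝ (Fin n)} (hx : DifferentiableAt ℝ φ x)
    (i : Fin n) (j : Fin p) :
    (jacGerm hφ i j).1 x = fderiv ℝ φ x (EuclideanSpace.single i 1) j := by
  have := ((EuclideanSpace.proj (𝕜 := ℝ) j).hasFDerivAt.comp x hx.hasFDerivAt).fderiv
  exact congrArg (fun l => l (EuclideanSpace.single i 1)) this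

/-- Evaluation of functions at a point, as a ring homomorphism. -/
def evalHom {E : Type} [NormedAddCommGroup E] [NormedSpace ℝ E] (x : E) :
    analyticAlg E →ₐ[ℝ] ℝ := (Pi.evalAlgHom ℝ (fun _ => ℝ) x).comp (analyticAlg E).val

theorem minor_jacGerm_apply {φ : EuclideanSpace ℝ (Fin n) → EuclideanSpace ℝ (Fin p)}
    (hφ : AnalyticAt ℝ φ 0) {x : EuclideanSpace ℝ (Fin n)} (hx : DifferentiableAt ℝ φ x)
    (ι : Fin p → Fin n) : (minor (jacGerm hφ) ι).1 x = kGen n p φ ι x := by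
  refine (map_minor (evalHom x : _ →+* ℝ) (jacGerm hφ) ι).trans ?_
  exact congrArg Matrix.det (funext fun j => funext fun k => jacGerm_apply hφ hx (ι k) j)

theorem borderedMinor_jacGerm_apply {φ : EuclideanSpace ℝ (Fin n) → EuclideanSpace ℝ (Fin p)}
    (hφ : AnalyticAt ℝ φ 0) {x : EuclideanSpace ℝ (Fin n)} (hx : DifferentiableAt ℝ φ x)
    (ι : Fin (p + 1) → Fin n) :
    (borderedMinor (jacGerm hφ) varGerm ι).1 x = tGen n p φ ι x := by
  refine (map_borderedMinor (evalHom x : _ →+* ℝ) (jacGerm hφ) varGerm ι).trans ?_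
  refine congrArg Matrix.det (funext fun j => funext fun k => ?_)
  split_ifs with h
  · exact jacGerm_apply hφ hx (ι k) ⟨j, h⟩
  · rfl

theorem exists_tangent_coeff {F : Type} [Field F] [Algebra ℝ F]
    {ev : analyticAlg (EuclideanSpace ℝ (Fin n)) →ₐ[ℝ] F} {hev : KillsZeroGerms ev}
    {D : analyticAlg (EuclideanSpace ℝ (Fin n)) →ₗ[ℝ] F} (hD : D ∈ tangent hev) :
    ∃ c : Fin n → F, ∀ f, D f = ∑ i, c i * ev (dirDeriv (EuclideanSpace.single i 1) f) := by
  induction hD using Submodule.span_induction with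
  | mem D hD =>
    obtain ⟨w, rfl⟩ := hD
    refine ⟨fun i => algebraMap ℝ F (w i), fun f => ?_⟩
    have : dirDeriv w f = ∑ i, w i • dirDeriv (EuclideanSpace.single i 1) f := by
      refine Subtype.ext (funext fun x => ?_)
      rw [sum_apply_analyticAlg]
      change fderiv ℝ f.1 x w = ∑ i, w i • fderiv ℝ f.1 x (EuclideanSpace.single i 1)
      conv_lhs => rw [← (EuclideanSpace.basisFun (Fin n) ℝ).sum_repr w]
      simp
    change ev (dirDeriv w f) = _
    rw [this, map_sum]
    refine Finset.sum_congr rfl fun i _ => ?_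
    rw [map_smul, Algebra.smul_def]
  | zero => exact ⟨0, fun f => by simp⟩
  | add D₁ D₂ _ _ h₁ h₂ =>
    obtain ⟨c₁, h₁⟩ := h₁
    obtain ⟨c₂, h₂⟩ := h₂
    refine ⟨c₁ + c₂, fun f => ?_⟩
    rw [LinearMap.add_apply, h₁, h₂, ← Finset.sum_add_distrib]
    exact Finset.sum_congr rfl fun i _ => (add_mul _ _ _).symm
  | smul a D _ h =>
    obtain ⟨c, h⟩ := h
    refine ⟨a • c, fun f => ?_⟩
    rw [LinearMap.smul_apply, h, smul_eq_mul, Finset.mul_sum]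
    exact Finset.sum_congr rfl fun i _ => (mul_assoc _ _ _).symm

theorem dirDeriv_varGerm (i k : Fin n) :
    dirDeriv (EuclideanSpace.single k 1) (varGerm i) = if i = k then 1 else 0 := by
  refine Subtype.ext (funext fun x => ?_)
  change fderiv ℝ (EuclideanSpace.proj (𝕜 := ℝ) i) x (EuclideanSpace.single k 1) = _
  rw [ContinuousLinearMap.fderiv]
  split_ifs with h
  · simp [h]
  · simp [h]

/-- An element killed by the tangent derivations and vanishing at the origin is zero. -/
theorem ev_eq_zero_of_isAlgebraic {E F : Type} [NormedAddCommGroup E] [NormedSpace ℝ E] [Field F]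
    [Algebra ℝ F] {ev : analyticAlg E →ₐ[ℝ] F} (hev : KillsZeroGerms ev) {f : analyticAlg E}
    (hf : f.1 0 = 0) (h : IsAlgebraic ℝ (ev f)) : ev f = 0 := by
  by_contra hne
  refine hev.apply_ne_zero (f := Polynomial.aeval f (minpoly ℝ (ev f))) ?_ ?_
  · change evalHom 0 (Polynomial.aeval f (minpoly ℝ (ev f))) ≠ 0
    rw [← Polynomial.aeval_algHom_apply]
    change Polynomial.aeval (f.1 0) _ ≠ 0
    rw [hf, ← Polynomial.coeff_zero_eq_aeval_zero]
    exact minpoly.coeff_zero_ne_zero h.isIntegral hne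
  · rw [← Polynomial.aeval_algHom_apply, minpoly.aeval]

theorem ev_rhoGerm_eq_zero {φ : EuclideanSpace ℝ (Fin n) → EuclideanSpace ℝ (Fin p)}
    (hφ : AnalyticAt ℝ φ 0) {F : Type} [Field F] [Algebra ℝ F]
    {ev : analyticAlg (EuclideanSpace ℝ (Fin n)) →ₐ[ℝ] F} (hev : KillsZeroGerms ev)
    (hfrac : ∀ x : F, ∃ a b, ev b ≠ 0 ∧ x = ev a / ev b) (h0 : ∀ j, ev (coordGerm hφ j) = 0)
    (hT : ∀ ι, StrictMono ι → ev (borderedMinor (jacGerm hφ) varGerm ι) = 0) {ι : Fin p → Fin n}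
    (hK : ev (minor (jacGerm hφ) ι) ≠ 0) : ev rhoGerm = 0 := by
  have : CharZero F := charZero_of_injective_algebraMap (algebraMap ℝ F).injective
  obtain ⟨c, hc⟩ := exists_multipliers (M := fun i j => ev (jacGerm hφ i j))
    (X := fun i => ev (varGerm i)) (ι := ι)
    (fun h => hK ((map_minor (ev : _ →+* F) (jacGerm hφ) ι).trans h))
    (borderedMinor_eq_zero fun κ hκ =>
      (map_borderedMinor (ev : _ →+* F) (jacGerm hφ) varGerm κ).symm.trans (hT κ hκ))
  refine ev_eq_zero_of_isAlgebraic hev (by rw [rhoGerm_apply]; simp) ?_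
  have h1 := constantsAlgebraic _ (EuclideanSpace ℝ (Fin n)) rfl F ev hev hfrac rhoGerm 1
    (by simp) ?_
  · simpa using h1
  intro D hD hDk
  have hone : D 1 = 0 := by
    have := tangent_leibniz hD 1 1
    rw [mul_one, map_one ev, one_mul, left_eq_add] at this
    exact this
  rw [hone, mul_zero, map_one ev, mul_one]
  obtain ⟨d, hd⟩ := exists_tangent_coeff hD
  have hvar : ∀ i, D (varGerm i) = d i := by
    intro i
    rw [hd]
    simp_rw [dirDeriv_varGerm]
    simp [apply_ite ev]
  calc D rhoGerm = ∑ i, 2 * (ev (varGerm i) * d i) := by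
        rw [rhoGerm, map_sum]
        refine Finset.sum_congr rfl fun i _ => ?_
        rw [pow_two, tangent_leibniz hD, hvar, ← two_mul]
    _ = 2 * ∑ i, ∑ j, c j * (d i * ev (jacGerm hφ i j)) := by
        rw [Finset.mul_sum]
        refine Finset.sum_congr rfl fun i _ => ?_
        rw [hc i, Finset.sum_mul]
        congr 1
        exact Finset.sum_congr rfl fun j _ => by ring
    _ = 2 * ∑ j, c j * D (coordGerm hφ j) := by
        rw [Finset.sum_comm]
        simp_rw [hd (coordGerm hφ _), Finset.mul_sum]
        rfl
    _ = 0 := by simp [fun j => hDk _ (h0 j)]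

end

section

variable {n p : ℕ}

open scoped Classical in
/-- The sum of the squares of the components of `φ` and of the functions `g ι`, for `ι` strictly
increasing. -/
noncomputable def sqSum {q : ℕ} (φ : EuclideanSpace ℝ (Fin n) → EuclideanSpace ℝ (Fin p))
    (g : (Fin q → Fin n) → EuclideanSpace ℝ (Fin n) → ℝ) (x : EuclideanSpace ℝ (Fin n)) : ℝ :=
  (∑ j, φ x j ^ 2) + ∑ ι : Fin q → Fin n, if StrictMono ι then g ι x ^ 2 else 0

/-- The ideal `I_T(φ)` of analytic functions, up to equality of germs. -/
noncomputable def tIdeal {φ : EuclideanSpace ℝ (Fin n) → EuclideanSpace ℝ (Fin p)}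
    (hφ : AnalyticAt ℝ φ 0) :
    Ideal (analyticAlg (EuclideanSpace ℝ (Fin n))) :=
  Ideal.span ({f | f.1 =ᶠ[𝓝 0] 0} ∪ Set.range (coordGerm hφ) ∪
    borderedMinor (jacGerm hφ) varGerm '' {ι | StrictMono ι})

theorem exists_field_of_isPrime {A : Type} [CommRing A] [Algebra ℝ A] (P : Ideal A) [P.IsPrime] :
    ∃ (F : Type) (_ : Field F) (_ : Algebra ℝ F) (ev : A →ₐ[ℝ] F),
      (∀ f, ev f = 0 ↔ f ∈ P) ∧ ∀ x : F, ∃ a b, ev b ≠ 0 ∧ x = ev a / ev b := by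
  let ev : A →ₐ[ℝ] FractionRing (A ⧸ P) :=
    (IsScalarTower.toAlgHom ℝ (A ⧸ P) (FractionRing (A ⧸ P))).comp (Ideal.Quotient.mkₐ ℝ P)
  have hev0 : ∀ f, ev f = 0 ↔ f ∈ P := by
    intro f
    change algebraMap (A ⧸ P) (FractionRing (A ⧸ P)) (Ideal.Quotient.mk P f) = 0 ↔ _
    rw [FaithfulSMul.algebraMap_eq_zero_iff, Ideal.Quotient.eq_zero_iff_mem]
  refine ⟨FractionRing (A ⧸ P), inferInstance, inferInstance, ev, hev0, fun x => ?_⟩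
  obtain ⟨a, b, hb, rfl⟩ := IsFractionRing.div_surjective (A := A ⧸ P) x
  obtain ⟨a, rfl⟩ := Ideal.Quotient.mk_surjective a
  obtain ⟨b, rfl⟩ := Ideal.Quotient.mk_surjective b
  refine ⟨a, b, fun h => nonZeroDivisors.ne_zero hb ?_, rfl⟩
  rw [Ideal.Quotient.eq_zero_iff_mem]
  exact (hev0 b).1 h

theorem rhoGerm_mul_minor_mem_radical {φ : EuclideanSpace ℝ (Fin n) → EuclideanSpace ℝ (Fin p)}
    (hφ : AnalyticAt ℝ φ 0) (ι : Fin p → Fin n) :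
    rhoGerm * minor (jacGerm hφ) ι ∈ (tIdeal hφ).radical := by
  rw [Ideal.radical_eq_sInf, Submodule.mem_sInf]
  intro (P : Ideal _) ⟨hP, hprime⟩
  by_cases hK : minor (jacGerm hφ) ι ∈ P
  · exact P.mul_mem_left _ hK
  refine P.mul_mem_right _ ?_
  obtain ⟨F, _, _, ev, hev0, hfrac⟩ := exists_field_of_isPrime P
  have hI : ∀ f ∈ ({f | f.1 =ᶠ[𝓝 0] 0} ∪ Set.range (coordGerm hφ) ∪
      borderedMinor (jacGerm hφ) varGerm '' {ι | StrictMono ι} : Set (analyticAlg _)), ev f = 0 :=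
    fun f hf => (hev0 f).2 (hP (Ideal.subset_span hf))
  rw [← hev0]
  exact ev_rhoGerm_eq_zero hφ (fun f hf => hI f (Or.inl (Or.inl hf))) hfrac
    (fun j => hI _ (Or.inl (Or.inr ⟨j, rfl⟩))) (fun κ hκ => hI _ (Or.inr ⟨κ, hκ, rfl⟩))
    fun h => hK ((hev0 _).1 h)

section

variable {q : ℕ} (φ : EuclideanSpace ℝ (Fin n) → EuclideanSpace ℝ (Fin p))
  (g : (Fin q → Fin n) → EuclideanSpace ℝ (Fin n) → ℝ) (x : EuclideanSpace ℝ (Fin n))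

theorem sum_sq_strictMono_nonneg :
    0 ≤ ∑ ι : Fin q → Fin n, open scoped Classical in if StrictMono ι then g ι x ^ 2 else 0 :=
  Finset.sum_nonneg fun ι _ => by split_ifs; exacts [sq_nonneg _, le_rfl]

theorem sqSum_nonneg : 0 ≤ sqSum φ g x :=
  add_nonneg (Finset.sum_nonneg fun _ _ => sq_nonneg _) (sum_sq_strictMono_nonneg g x)

theorem sq_le_sqSum_left (j : Fin p) : φ x j ^ 2 ≤ sqSum φ g x :=
  (Finset.single_le_sum (f := fun j => φ x j ^ 2) (fun _ _ => sq_nonneg _)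
    (Finset.mem_univ j)).trans (le_add_of_nonneg_right (sum_sq_strictMono_nonneg g x))

open scoped Classical in
theorem sq_le_sqSum_right {ι : Fin q → Fin n} (hι : StrictMono ι) :
    g ι x ^ 2 ≤ sqSum φ g x := by
  have h := Finset.single_le_sum
    (f := fun ι : Fin q → Fin n => if StrictMono ι then g ι x ^ 2 else 0)
    (fun ι _ => by split_ifs; exacts [sq_nonneg _, le_rfl]) (Finset.mem_univ ι)
  simp only [hι, if_true] at h
  exact h.trans (le_add_of_nonneg_left (Finset.sum_nonneg fun j _ => sq_nonneg (φ x j)))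

end

section

variable {E : Type} [NormedAddCommGroup E] {f g κ : E → ℝ}

/-- Near the origin, the square of `f` is bounded by a multiple of `κ`. -/
def SqDominated (f κ : E → ℝ) : Prop := ∃ C : ℝ, ∀ᶠ x in 𝓝 0, f x ^ 2 ≤ C * κ x

theorem SqDominated.add (hf : SqDominated f κ) (hg : SqDominated g κ) :
    SqDominated (fun x => f x + g x) κ := by
  obtain ⟨C, hf⟩ := hf
  obtain ⟨C', hg⟩ := hg
  refine ⟨2 * (C + C'), ?_⟩
  filter_upwards [hf, hg] with x hf hg
  nlinarith [sq_nonneg (f x - g x)]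

theorem SqDominated.mul (hf : SqDominated f κ) (hg : ContinuousAt g 0) :
    SqDominated (fun x => g x * f x) κ := by
  obtain ⟨C, hf⟩ := hf
  refine ⟨(g 0 ^ 2 + 1) * C, ?_⟩
  have h1 : ∀ᶠ x in 𝓝 0, g x ^ 2 < g 0 ^ 2 + 1 :=
    (hg.pow 2).eventually_lt_const (lt_add_one _)
  filter_upwards [hf, h1] with x hf h1
  rw [mul_pow, mul_assoc]
  exact mul_le_mul h1.le hf (sq_nonneg _) (by positivity)

theorem SqDominated.zero : SqDominated (fun _ => 0) κ :=
  ⟨0, Eventually.of_forall fun x => by simp⟩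

theorem SqDominated.sum {α : Type} (s : Finset α) {f : α → E → ℝ}
    (h : ∀ i ∈ s, SqDominated (f i) κ) : SqDominated (fun x => ∑ i ∈ s, f i x) κ := by
  classical
  induction s using Finset.induction_on with
  | empty => simpa using SqDominated.zero
  | insert i s hi ih =>
    simp only [Finset.sum_insert hi]
    exact (h i (Finset.mem_insert_self i s)).add
      (ih fun k hk => h k (Finset.mem_insert_of_mem hk))

end

theorem sqDominated_of_mem_tIdeal {φ : EuclideanSpace ℝ (Fin n) → EuclideanSpace ℝ (Fin p)}
    (hφ : AnalyticAt ℝ φ 0) {f : analyticAlg (EuclideanSpace ℝ (Fin n))} (hf : f ∈ tIdeal hφ) :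
    SqDominated f.1 (sqSum φ (tGen n p φ)) := by
  induction hf using Submodule.span_induction with
  | mem f hf =>
    rcases hf with (hf | ⟨j, rfl⟩) | ⟨ι, hι, rfl⟩
    · refine ⟨0, ?_⟩
      filter_upwards [hf] with x hx
      rw [hx]
      simp
    · exact ⟨1, Eventually.of_forall fun x => by rw [one_mul]; exact sq_le_sqSum_left φ _ x j⟩
    · refine ⟨1, ?_⟩
      filter_upwards [hφ.eventually_analyticAt] with x hx
      rw [one_mul, borderedMinor_jacGerm_apply hφ hx.differentiableAt]
      exact sq_le_sqSum_right φ _ x hι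
  | zero => exact SqDominated.zero
  | add f g _ _ hf hg => exact hf.add hg
  | smul a f _ hf => exact hf.mul a.2.continuousAt

/-- The comparison of the two ideals. -/
theorem exists_pow_sqSum_le {φ : EuclideanSpace ℝ (Fin n) → EuclideanSpace ℝ (Fin p)}
    (hφ : AnalyticAt ℝ φ 0) :
    ∃ (k : ℕ) (C : ℝ), ∀ᶠ x in 𝓝 0,
      (‖x‖ ^ 2 * sqSum φ (kGen n p φ) x) ^ k ≤ C * sqSum φ (tGen n p φ) x := by
  classical
  let g : analyticAlg (EuclideanSpace ℝ (Fin n)) := (∑ j, coordGerm hφ j ^ 2) +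
    ∑ ι : Fin p → Fin n, if StrictMono ι then minor (jacGerm hφ) ι ^ 2 else 0
  have hg : rhoGerm * g ∈ (tIdeal hφ).radical := by
    rw [mul_add, Finset.mul_sum, Finset.mul_sum]
    refine Ideal.add_mem _ (Ideal.sum_mem _ fun j _ => ?_) (Ideal.sum_mem _ fun ι _ => ?_)
    · rw [pow_two]
      exact Ideal.mul_mem_left _ _ (Ideal.mul_mem_left _ _
        (Ideal.le_radical (Ideal.subset_span (Or.inl (Or.inr ⟨j, rfl⟩)))))
    · split_ifs
      · rw [pow_two, ← mul_assoc]
        exact Ideal.mul_mem_right _ _ (rhoGerm_mul_minor_mem_radical hφ ι)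
      · rw [mul_zero]
        exact Ideal.zero_mem _
  obtain ⟨k, hk⟩ := hg
  obtain ⟨C, hC⟩ := sqDominated_of_mem_tIdeal hφ hk
  refine ⟨k * 2, C, ?_⟩
  filter_upwards [hC, hφ.eventually_analyticAt] with x hx ha
  have hgx : g.1 x = sqSum φ (kGen n p φ) x := by
    change (∑ j, coordGerm hφ j ^ 2).1 x + (∑ ι : Fin p → Fin n,
      if StrictMono ι then minor (jacGerm hφ) ι ^ 2 else 0).1 x = _
    rw [sum_apply_analyticAlg, sum_apply_analyticAlg, sqSum]
    congr 1
    refine Finset.sum_congr rfl fun ι _ => ?_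
    split_ifs
    · rw [← minor_jacGerm_apply hφ ha.differentiableAt]
      rfl
    · rfl
  change ((rhoGerm.1 x * g.1 x) ^ k) ^ 2 ≤ _ at hx
  rwa [rhoGerm_apply, hgx, ← pow_mul] at hx

end

section

variable {n p : ℕ}

theorem tGen_eq_sum (φ : EuclideanSpace ℝ (Fin n) → EuclideanSpace ℝ (Fin p))
    (ι : Fin (p + 1) → Fin n) (x : EuclideanSpace ℝ (Fin n)) :
    tGen n p φ ι x = ∑ k : Fin (p + 1),
      (-1) ^ (p + (k : ℕ)) * (2 * x (ι k)) * kGen n p φ (ι ∘ k.succAbove) x := by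
  refine (Matrix.det_succ_row _ (Fin.last p)).trans (Finset.sum_congr rfl fun k _ => ?_)
  congr 1
  · simp
  · refine congrArg Matrix.det (funext fun i => funext fun j => ?_)
    rw [Fin.succAbove_last]
    exact dif_pos i.2

theorem MemIT.memIK {φ : EuclideanSpace ℝ (Fin n) → EuclideanSpace ℝ (Fin p)}
    {h : EuclideanSpace ℝ (Fin n) → ℝ} (H : MemIT n p φ h) : MemIK n p φ h := by
  classical
  obtain ⟨U, hU, a, b, ha, hb, hh⟩ := H
  refine ⟨U, hU, a, fun ι x => ∑ κ : Fin (p + 1) → Fin n, ∑ k : Fin (p + 1),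
    if StrictMono κ ∧ κ ∘ k.succAbove = ι then
      b κ x * ((-1) ^ (p + (k : ℕ)) * (2 * x (κ k))) else 0, ha, fun ι => ?_, fun x hx => ?_⟩
  · refine ContDiffOn.sum fun κ _ => ContDiffOn.sum fun k _ => ?_
    split_ifs
    · refine (hb κ).mul (ContDiff.contDiffOn ?_)
      exact contDiff_const.mul (contDiff_const.mul (EuclideanSpace.proj (𝕜 := ℝ) (κ k)).contDiff)
    · exact contDiffOn_const
  · rw [hh x hx]
    congr 1
    have h1 : ∀ ι : Fin p → Fin n, (if StrictMono ι then (∑ κ : Fin (p + 1) → Fin n,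
        ∑ k : Fin (p + 1), if StrictMono κ ∧ κ ∘ k.succAbove = ι then
          b κ x * ((-1) ^ (p + (k : ℕ)) * (2 * x (κ k))) else 0) * kGen n p φ ι x else 0) =
        ∑ κ : Fin (p + 1) → Fin n, ∑ k : Fin (p + 1), if κ ∘ k.succAbove = ι then
          (if StrictMono κ then b κ x * ((-1) ^ (p + (k : ℕ)) * (2 * x (κ k)) *
            kGen n p φ (κ ∘ k.succAbove) x) else 0) else 0 := by
      intro ι
      by_cases hι : StrictMono ι
      · rw [if_pos hι, Finset.sum_mul]
        refine Finset.sum_congr rfl fun κ _ => ?_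
        rw [Finset.sum_mul]
        refine Finset.sum_congr rfl fun k _ => ?_
        by_cases hk : κ ∘ k.succAbove = ι
        · subst hk
          by_cases hκ : StrictMono κ <;> simp [hκ, mul_assoc]
        · simp [hk]
      · rw [if_neg hι]
        refine (Finset.sum_eq_zero fun κ _ => Finset.sum_eq_zero fun k _ => ?_).symm
        by_cases hk : κ ∘ k.succAbove = ι
        · have hκ : ¬ StrictMono κ := fun hκ => hι (hk ▸ hκ.comp (Fin.strictMono_succAbove k))
          simp [hκ]
        · simp [hk]
    simp_rw [h1]
    rw [Finset.sum_comm]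
    refine Finset.sum_congr rfl fun κ _ => ?_
    rw [Finset.sum_comm]
    simp only [Finset.sum_ite_eq, Finset.mem_univ, if_true]
    split_ifs
    · rw [tGen_eq_sum, Finset.mul_sum]
    · simp

end

section

open scoped ContDiff

theorem norm_iteratedFDeriv_scaled_le {E : Type} [NormedAddCommGroup E]
    [NormedSpace ℝ E] {f : E → ℝ} (hf : ContDiff ℝ ∞ f) {j : ℕ} {M : ℝ}
    (hM : ∀ x, ‖iteratedFDeriv ℝ j f x‖ ≤ M) (a c : ℝ) (y x : E) :
    ‖iteratedFDeriv ℝ j (fun z => a * f (c • (z - y))) x‖ ≤ |a| * (M * |c| ^ j) := by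
  have hj : (j : WithTop ℕ∞) ≤ ∞ := by exact_mod_cast le_top
  let g : E →L[ℝ] E := c • ContinuousLinearMap.id ℝ E
  have h1 : iteratedFDeriv ℝ j (fun z => a * f (c • (z - y))) x =
      a • (iteratedFDeriv ℝ j f (g (x - y))).compContinuousLinearMap fun _ => g := by
    have hfg : ContDiff ℝ ∞ (fun z => (f ∘ g) (z - y)) :=
      (hf.comp g.contDiff).comp (contDiff_id.sub contDiff_const)
    rw [← g.iteratedFDeriv_comp_right hf _ hj, ← iteratedFDeriv_comp_sub (f := f ∘ g),
      ← iteratedFDeriv_const_smul_apply' (hfg.contDiffAt.of_le hj)]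
    rfl
  rw [h1, norm_smul, Real.norm_eq_abs]
  refine mul_le_mul_of_nonneg_left ?_ (abs_nonneg a)
  refine (ContinuousMultilinearMap.norm_compContinuousLinearMap_le _ _).trans ?_
  have hM0 : 0 ≤ M := (norm_nonneg _).trans (hM 0)
  have hg : ‖g‖ ≤ |c| := by
    refine g.opNorm_le_bound (abs_nonneg c) fun z => ?_
    change ‖c • z‖ ≤ _
    rw [norm_smul, Real.norm_eq_abs]
  rw [Finset.prod_const, Finset.card_univ, Fintype.card_fin]
  exact mul_le_mul (hM _) (pow_le_pow_left₀ (norm_nonneg _) hg _) (by positivity) hM0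

variable {E : Type} [NormedAddCommGroup E] [InnerProductSpace ℝ E] [FiniteDimensional ℝ E]

theorem exists_bound_iteratedFDeriv_bump (χ : ContDiffBump (0 : E)) (j : ℕ) :
    ∃ M : ℝ, 0 ≤ M ∧ ∀ x, ‖iteratedFDeriv ℝ j χ x‖ ≤ M := by
  obtain ⟨M, hM⟩ := (χ.hasCompactSupport.iteratedFDeriv (𝕜 := ℝ) j).exists_bound_of_continuous
    ((χ.contDiff (n := ⊤)).continuous_iteratedFDeriv (by exact_mod_cast le_top))
  exact ⟨M, (norm_nonneg _).trans (hM 0), hM⟩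

/-- A nonnegative function which is not bounded below by a power of the distance to `S` does not
dominate all the functions flat on `S`. -/
theorem exists_flat_not_le {S : Set E} (h0S : (0 : E) ∈ S) {κ : E → ℝ}
    (hκ : ∀ x, 0 ≤ κ x)
    (h : ∀ k : ℕ, ∃ᶠ x in 𝓝 0, κ x < Metric.infDist x S ^ k) :
    ∃ f : E → ℝ, ContDiff ℝ ∞ f ∧ (∀ k, ∀ x ∈ S, iteratedFDeriv ℝ k f x = 0) ∧
      ∀ C : ℝ, ¬ ∀ᶠ x in 𝓝 0, f x ^ 2 ≤ C * κ x := by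
  have hx : ∀ k : ℕ, ∃ x : E, ‖x‖ < (1 / 2) ^ k ∧ κ x < Metric.infDist x S ^ (2 * k + 1) := by
    intro k
    obtain ⟨x, hx, hxk⟩ := ((h (2 * k + 1)).and_eventually
      (Metric.ball_mem_nhds (0 : E) (show (0 : ℝ) < (1 / 2) ^ k by positivity))).exists
    exact ⟨x, mem_ball_zero_iff.1 hxk, hx⟩
  choose x hxn hxκ using hx
  let d : ℕ → ℝ := fun k => Metric.infDist (x k) S
  have hd0 : ∀ k, 0 < d k := by
    intro k
    refine Metric.infDist_nonneg.lt_of_ne fun h0 => ?_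
    have := (hκ _).trans_lt (hxκ k)
    rw [← h0, zero_pow (by omega)] at this
    exact lt_irrefl _ this
  have hd1 : ∀ k, d k ≤ (1 / 2) ^ k := by
    intro k
    refine (Metric.infDist_le_dist_of_mem h0S).trans ?_
    rw [dist_zero_right]
    exact (hxn k).le
  have hd1' : ∀ k, d k ≤ 1 := fun k => (hd1 k).trans (pow_le_one₀ (by norm_num) (by norm_num))
  let χ : ContDiffBump (0 : E) := ⟨1 / 4, 1 / 2, by norm_num, by norm_num⟩
  choose M hM0 hM using exists_bound_iteratedFDeriv_bump χ
  let g : ℕ → E → ℝ := fun k z => d k ^ k * χ ((d k)⁻¹ • (z - x k))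
  let v : ℕ → ℕ → ℝ := fun j k => d k ^ k * (M j * (d k)⁻¹ ^ j)
  have hg : ∀ k, ContDiff ℝ ∞ (g k) := fun k =>
    contDiff_const.mul (χ.contDiff.comp (contDiff_const.smul (contDiff_id.sub contDiff_const)))
  have hv : ∀ j : ℕ, (j : ℕ∞) ≤ ⊤ → Summable (v j) := by
    intro j _
    refine Summable.of_norm_bounded_eventually_nat (g := fun k => M j * (1 / 2 : ℝ) ^ k)
      ((summable_geometric_of_lt_one (by norm_num) (by norm_num)).mul_left _) ?_
    filter_upwards [eventually_ge_atTop (j + 1)] with k hk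
    have h0 := hd0 k
    have h1 : v j k = M j * d k ^ (k - j) := by
      rw [pow_sub₀ _ h0.ne' (by omega)]
      simp only [v, inv_pow]
      ring
    rw [Real.norm_eq_abs, abs_of_nonneg (by have := hM0 j; positivity), h1]
    refine mul_le_mul_of_nonneg_left ?_ (hM0 j)
    exact (pow_le_of_le_one h0.le (hd1' k) (by omega)).trans (hd1 k)
  have hgv : ∀ (j k : ℕ) (z : E), (j : ℕ∞) ≤ ⊤ → ‖iteratedFDeriv ℝ j (g k) z‖ ≤ v j k := by
    intro j k z _
    have := norm_iteratedFDeriv_scaled_le χ.contDiff (hM j) (d k ^ k) (d k)⁻¹ (x k) z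
    rwa [abs_of_pos (pow_pos (hd0 k) k), abs_of_pos (inv_pos.2 (hd0 k))] at this
  refine ⟨fun z => ∑' k, g k z, contDiff_tsum hg hv hgv, fun j s hs => ?_, fun C hC => ?_⟩
  · rw [iteratedFDeriv_tsum_apply hg hv hgv le_top]
    refine (tsum_congr fun k => ?_).trans tsum_zero
    have : g k =ᶠ[𝓝 s] 0 := by
      filter_upwards [Metric.ball_mem_nhds s (half_pos (hd0 k))] with z hz
      have h1 : d k ≤ dist (x k) s := Metric.infDist_le_dist_of_mem hs
      have h2 : d k / 2 ≤ ‖z - x k‖ := by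
        have := dist_triangle_left (x k) s z
        rw [Metric.mem_ball] at hz
        rw [← dist_eq_norm]
        linarith
      have : χ ((d k)⁻¹ • (z - x k)) = 0 := by
        refine χ.zero_of_le_dist ?_
        rw [dist_zero_right, norm_smul, norm_inv, Real.norm_eq_abs, abs_of_pos (hd0 k)]
        rw [← div_eq_inv_mul, le_div_iff₀ (hd0 k)]
        change 1 / 2 * d k ≤ _
        linarith
      simp only [g, this, mul_zero, Pi.zero_apply]
    have h2 := this.iteratedFDeriv ℝ j
    rw [h2.self_of_nhds]
    simp
  · have hxlim : Tendsto x atTop (𝓝 0) :=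
      squeeze_zero_norm (fun k => (hxn k).le)
        (tendsto_pow_atTop_nhds_zero_of_lt_one (by norm_num) (by norm_num))
    have hdlim : Tendsto d atTop (𝓝 0) :=
      squeeze_zero (fun k => (hd0 k).le) hd1
        (tendsto_pow_atTop_nhds_zero_of_lt_one (by norm_num) (by norm_num))
    have h2 : ∀ᶠ k in atTop, |C| * d k < 1 := by
      have := hdlim.const_mul |C|
      rw [mul_zero] at this
      exact this.eventually_lt_const one_pos
    obtain ⟨k, hk, hk1⟩ := ((hxlim.eventually hC).and h2).exists
    have hsum : Summable fun i => g i (x k) := by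
      refine Summable.of_norm_bounded (hv 0 le_top) fun i => ?_
      have := hgv 0 i (x k) le_top
      rwa [norm_iteratedFDeriv_zero] at this
    have h3 : d k ^ k ≤ ∑' i, g i (x k) := by
      have h4 : g k (x k) = d k ^ k := by
        have : χ 0 = 1 := χ.one_of_mem_closedBall (by simp [χ.rIn_pos.le])
        simp [g, this]
      rw [← h4]
      exact hsum.le_tsum k fun i _ => mul_nonneg (pow_nonneg (hd0 i).le i) χ.nonneg
    have h5 : (d k ^ k) ^ 2 ≤ |C| * d k ^ (2 * k + 1) :=
      calc (d k ^ k) ^ 2 ≤ (∑' i, g i (x k)) ^ 2 :=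
            pow_le_pow_left₀ (pow_nonneg (hd0 k).le k) h3 2
        _ ≤ C * κ (x k) := hk
        _ ≤ |C| * κ (x k) := mul_le_mul_of_nonneg_right (le_abs_self C) (hκ _)
        _ ≤ _ := mul_le_mul_of_nonneg_left (hxκ k).le (abs_nonneg C)
    have h6 : 0 < d k ^ (2 * k) := pow_pos (hd0 k) _
    rw [← pow_mul, mul_comm k 2, pow_succ] at h5
    nlinarith

end

section

open scoped ContDiff

variable {E : Type} [NormedAddCommGroup E] [NormedSpace ℝ E] {S U : Set E}
  {V W : Type} [NormedAddCommGroup V] [NormedSpace ℝ V] [NormedAddCommGroup W] [NormedSpace ℝ W]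

/-- `f` is smooth on `U` and all its derivatives vanish on `S ∩ U`. -/
def IsFlatOn (S U : Set E) (f : E → V) : Prop :=
  ContDiffOn ℝ ∞ f U ∧ ∀ k : ℕ, ∀ x ∈ S ∩ U, iteratedFDeriv ℝ k f x = 0

theorem IsFlatOn.eq_zero {f : E → V} (hf : IsFlatOn S U f) {x : E} (hx : x ∈ S ∩ U) : f x = 0 := by
  have h := hf.2 0 x hx
  rw [← norm_eq_zero, norm_iteratedFDeriv_zero, norm_eq_zero] at h
  exact h

theorem IsFlatOn.fderiv {f : E → V} (hf : IsFlatOn S U f) (hU : IsOpen U) :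
    IsFlatOn S U (fderiv ℝ f) :=
  ⟨((contDiffOn_infty_iff_fderiv_of_isOpen hU).1 hf.1).2, fun k x hx => by
    rw [← norm_eq_zero, norm_iteratedFDeriv_fderiv, hf.2 (k + 1) x hx, norm_zero]⟩

theorem IsFlatOn.add {f g : E → V} (hf : IsFlatOn S U f) (hg : IsFlatOn S U g) (hU : IsOpen U) :
    IsFlatOn S U (fun x => f x + g x) := by
  refine ⟨hf.1.add hg.1, fun k x hx => ?_⟩
  have hk : (k : WithTop ℕ∞) ≤ ∞ := by exact_mod_cast le_top
  have h := fun_iteratedFDeriv_add_apply ((hf.1.contDiffAt (hU.mem_nhds hx.2)).of_le hk)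
    ((hg.1.contDiffAt (hU.mem_nhds hx.2)).of_le hk)
  rw [h, hf.2 k x hx, hg.2 k x hx, add_zero]

theorem IsFlatOn.bilinear {X : Type} [NormedAddCommGroup X] [NormedSpace ℝ X]
    (B : X →L[ℝ] V →L[ℝ] W) {g : E → X} {f : E → V} (hf : IsFlatOn S U f)
    (hg : ContDiffOn ℝ ∞ g U) (hU : IsOpen U) : IsFlatOn S U (fun x => B (g x) (f x)) := by
  refine ⟨B.isBoundedBilinearMap.contDiff.comp_contDiffOn (hg.prodMk hf.1), fun k x hx => ?_⟩
  have hk : (k : WithTop ℕ∞) ≤ ∞ := by exact_mod_cast le_top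
  have h := B.norm_iteratedFDerivWithin_le_of_bilinear hg hf.1 hU.uniqueDiffOn hx.2 hk
  rw [iteratedFDerivWithin_of_isOpen k hU hx.2] at h
  rw [← norm_le_zero_iff]
  refine h.trans (le_of_eq (mul_eq_zero_of_right _ (Finset.sum_eq_zero fun i _ => ?_)))
  rw [iteratedFDerivWithin_of_isOpen (k - i) hU hx.2, hf.2 _ x hx, norm_zero, mul_zero]

theorem IsFlatOn.norm_le_infDist_pow [ProperSpace E] (hS : IsClosed S) (hU : IsOpen U) {s : E}
    (hs : s ∈ S ∩ U) (N : ℕ) {f : E → V} (hf : IsFlatOn S U f) :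
    ∃ C : ℝ, ∀ᶠ x in 𝓝 s, ‖f x‖ ≤ C * Metric.infDist x S ^ N := by
  induction N generalizing V with
  | zero =>
    refine ⟨‖f s‖ + 1, ?_⟩
    have h : ContinuousAt (fun x => ‖f x‖) s :=
      (hf.1.continuousOn.continuousAt (hU.mem_nhds hs.2)).norm
    filter_upwards [h.eventually_lt_const (lt_add_one ‖f s‖)] with x hx
    simpa using hx.le
  | succ N ih =>
    obtain ⟨C, hC⟩ := ih (hf.fderiv hU)
    obtain ⟨r, hr, hball⟩ := Metric.eventually_nhds_iff_ball.1 (hC.and (hU.mem_nhds hs.2))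
    refine ⟨C, ?_⟩
    filter_upwards [Metric.ball_mem_nhds s (half_pos hr)] with x hx
    obtain ⟨t, htS, ht⟩ := hS.exists_infDist_eq_dist ⟨s, hs.1⟩ x
    rw [Metric.mem_ball] at hx
    have hxt : dist x t ≤ dist x s := ht ▸ Metric.infDist_le_dist_of_mem hs.1
    have hseg : ∀ y ∈ segment ℝ t x, y ∈ Metric.ball s r := fun y hy =>
      (convex_ball s r).segment_subset
        (by rw [Metric.mem_ball]; linarith [dist_triangle t x s, dist_comm t x])
        (by rw [Metric.mem_ball]; linarith) hy
    have hd : ∀ y ∈ segment ℝ t x, Metric.infDist y S ≤ Metric.infDist x S := fun y hy => by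
      refine (Metric.infDist_le_dist_of_mem htS).trans ?_
      rw [ht, dist_comm y t, dist_comm x t]
      linarith [dist_add_dist_of_mem_segment hy, dist_nonneg (x := y) (y := x)]
    have hC0 : ∀ y ∈ segment ℝ t x, ‖_root_.fderiv ℝ f y‖ ≤ C * Metric.infDist x S ^ N := by
      intro y hy
      rcases le_or_gt 0 C with h0 | h0
      · exact (hball y (hseg y hy)).1.trans (mul_le_mul_of_nonneg_left
          (pow_le_pow_left₀ Metric.infDist_nonneg (hd y hy) N) h0)
      · have h1 := (hball x (hseg x (right_mem_segment ℝ t x))).1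
        have h2 : 0 ≤ C * Metric.infDist x S ^ N := (norm_nonneg _).trans h1
        have h3 := (hball y (hseg y hy)).1
        have h4 : C * Metric.infDist y S ^ N ≤ 0 :=
          mul_nonpos_of_nonpos_of_nonneg h0.le (pow_nonneg Metric.infDist_nonneg _)
        linarith
    have h := (convex_segment t x).norm_image_sub_le_of_norm_fderiv_le (𝕜 := ℝ)
      (fun y hy => (hf.1.contDiffAt (hU.mem_nhds (hball y (hseg y hy)).2)).differentiableAt
        (by simp)) hC0 (left_mem_segment ℝ t x) (right_mem_segment ℝ t x)
    rw [hf.eq_zero ⟨htS, (hball t (hseg t (left_mem_segment ℝ t x))).2⟩, sub_zero,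
      ← dist_eq_norm, ← ht] at h
    rw [pow_succ, ← mul_assoc]
    exact h

/-- Flat functions may be divided by a function bounded below by a power of the distance. -/
theorem IsFlatOn.contDiffOn_inv_smul [ProperSpace E] (hS : IsClosed S) (hne : S.Nonempty)
    (hU : IsOpen U) {G : E → ℝ} (hG : ContDiffOn ℝ ∞ G U) {c : ℝ} (hc : 0 < c) {β : ℕ}
    (hGd : ∀ x ∈ U, c * Metric.infDist x S ^ β ≤ G x) (k m : ℕ) {f : E → V}
    (hf : IsFlatOn S U f) : ContDiffOn ℝ k (fun x => (G x ^ m)⁻¹ • f x) U := by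
  have hpos : ∀ x ∈ U, x ∉ S → 0 < c * Metric.infDist x S ^ β := fun x hx hxS =>
    mul_pos hc (pow_pos ((hS.notMem_iff_infDist_pos hne).1 hxS) β)
  have hg : ∀ (m : ℕ) {V : Type} [NormedAddCommGroup V] [NormedSpace ℝ V] {f : E → V},
      IsFlatOn S U f → IsFlatOn S U fun x => G x • _root_.fderiv ℝ f x +
        ContinuousLinearMap.smulRightL ℝ E V (-(m : ℝ) • _root_.fderiv ℝ G x) (f x) :=
    fun m V _ _ f hf => ((hf.fderiv hU).bilinear (ContinuousLinearMap.lsmul ℝ ℝ) hG hU).add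
      (hf.bilinear _ (((contDiffOn_infty_iff_fderiv_of_isOpen hU).1 hG).2.const_smul _) hU) hU
  have hderiv : ∀ (m : ℕ) {V : Type} [NormedAddCommGroup V] [NormedSpace ℝ V] {f : E → V},
      IsFlatOn S U f → ∀ x ∈ U, HasFDerivAt (fun x => (G x ^ m)⁻¹ • f x)
        ((G x ^ (m + 1))⁻¹ • (G x • _root_.fderiv ℝ f x +
          ContinuousLinearMap.smulRightL ℝ E V (-(m : ℝ) • _root_.fderiv ℝ G x) (f x))) x := by
    intro m V _ _ f hf x hx
    by_cases hxS : x ∈ S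
    · rw [(hg m hf).eq_zero ⟨hxS, hx⟩, smul_zero]
      refine Asymptotics.IsBigO.hasFDerivAt (n := 2) ?_ one_lt_two
      obtain ⟨C, hC⟩ := hf.norm_le_infDist_pow hS hU ⟨hxS, hx⟩ (β * m + 2)
      refine Asymptotics.IsBigO.of_bound ((c ^ m)⁻¹ * |C|) ?_
      filter_upwards [hC, hU.mem_nhds hx] with y hy hyU
      rw [norm_smul, norm_inv, norm_pow, Real.norm_eq_abs, norm_pow, norm_norm]
      have hd : Metric.infDist y S ≤ ‖y - x‖ := by
        rw [← dist_eq_norm]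
        exact Metric.infDist_le_dist_of_mem hxS
      by_cases hyS : y ∈ S
      · rw [hf.eq_zero ⟨hyS, hyU⟩, norm_zero, mul_zero]
        positivity
      have h0 := hpos y hyU hyS
      have hd0 : 0 < Metric.infDist y S := (hS.notMem_iff_infDist_pos hne).1 hyS
      calc (|G y| ^ m)⁻¹ * ‖f y‖
          ≤ ((c * Metric.infDist y S ^ β) ^ m)⁻¹ * (|C| * Metric.infDist y S ^ (β * m + 2)) := by
            gcongr
            · exact (hGd y hyU).trans (le_abs_self _)
            · exact hy.trans (mul_le_mul_of_nonneg_right (le_abs_self C) (by positivity))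
        _ = (c ^ m)⁻¹ * |C| * Metric.infDist y S ^ 2 := by
            rw [mul_pow, ← pow_mul, pow_add]
            field_simp
        _ ≤ (c ^ m)⁻¹ * |C| * ‖y - x‖ ^ 2 := by gcongr
    · have hGx : G x ≠ 0 := ((hpos x hx hxS).trans_le (hGd x hx)).ne'
      have h1 : HasFDerivAt f (_root_.fderiv ℝ f x) x :=
        ((hf.1.contDiffAt (hU.mem_nhds hx)).differentiableAt (by simp)).hasFDerivAt
      have h2 : HasFDerivAt G (_root_.fderiv ℝ G x) x :=
        ((hG.contDiffAt (hU.mem_nhds hx)).differentiableAt (by simp)).hasFDerivAt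
      have h3 := (hasDerivAt_inv (pow_ne_zero m hGx)).comp_hasFDerivAt x (h2.pow m)
      refine (h3.smul h1).congr_fderiv ?_
      ext v
      simp only [add_apply, smul_apply,
        ContinuousLinearMap.smulRight_apply, ContinuousLinearMap.smulRightL_apply_apply]
      rcases m with _ | m
      · simp [smul_smul, hGx]
      simp only [smul_add, smul_smul, smul_eq_mul, nsmul_eq_mul, Nat.add_sub_cancel,
        Function.comp_apply]
      congr 2
      all_goals
        field_simp
        ring
  induction k generalizing V m with
  | zero =>
    exact contDiffOn_zero.2 fun x hx => (hderiv m hf x hx).continuousAt.continuousWithinAt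
  | succ k ih =>
    refine (contDiffOn_succ_iff_fderiv_of_isOpen hU).2
      ⟨fun x hx => (hderiv m hf x hx).differentiableAt.differentiableWithinAt,
        fun h => absurd h (WithTop.coe_ne_top (a := (k : ℕ∞))), ?_⟩
    exact (ih (m + 1) (hg m hf)).congr fun x hx => (hderiv m hf x hx).fderiv

end

section

open scoped ContDiff

variable {n p : ℕ} {φ : EuclideanSpace ℝ (Fin n) → EuclideanSpace ℝ (Fin p)}

theorem analyticAt_tGen (hφ : AnalyticAt ℝ φ 0) (ι : Fin (p + 1) → Fin n) :
    AnalyticAt ℝ (tGen n p φ ι) 0 :=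
  (borderedMinor (jacGerm hφ) varGerm ι).2.congr <| hφ.eventually_analyticAt.mono fun _ hx =>
    borderedMinor_jacGerm_apply hφ hx.differentiableAt ι

theorem MemIK.sqDominated {h : EuclideanSpace ℝ (Fin n) → ℝ} (H : MemIK n p φ h) :
    SqDominated h (sqSum φ (kGen n p φ)) := by
  obtain ⟨U, hU, a, b, ha, hb, hh⟩ := H
  have key := (SqDominated.sum Finset.univ fun j _ =>
      SqDominated.mul (κ := sqSum φ (kGen n p φ)) (f := fun x => φ x j)
        ⟨1, Eventually.of_forall fun x => by rw [one_mul]; exact sq_le_sqSum_left φ _ x j⟩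
        ((ha j).continuousOn.continuousAt hU)).add
    (SqDominated.sum Finset.univ fun (ι : Fin p → Fin n) _ =>
      (show SqDominated (fun x => open scoped Classical in
        if StrictMono ι then b ι x * kGen n p φ ι x else 0) (sqSum φ (kGen n p φ)) by
        by_cases hι : StrictMono ι
        · simp only [hι, if_true]
          exact SqDominated.mul
            ⟨1, Eventually.of_forall fun x => by rw [one_mul]; exact sq_le_sqSum_right φ _ x hι⟩
            ((hb ι).continuousOn.continuousAt hU)
        · simp only [hι, if_false]
          exact SqDominated.zero))
  obtain ⟨C, hC⟩ := key
  refine ⟨C, ?_⟩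
  filter_upwards [hC, hU] with x hx hxU
  rw [hh x hxU]
  exact hx

theorem exists_mul_infDist_pow_le_sqSum (hφ : AnalyticAt ℝ φ 0)
    {S : Set (EuclideanSpace ℝ (Fin n))} (h0S : (0 : EuclideanSpace ℝ (Fin n)) ∈ S)
    (H : ∀ h, FlatOnSet n S h → MemIK n p φ h) :
    ∃ c > (0 : ℝ), ∃ β : ℕ, ∀ᶠ x in 𝓝 0,
      c * Metric.infDist x S ^ β ≤ sqSum φ (tGen n p φ) x := by
  have h1 : ∃ k : ℕ, ∀ᶠ x in 𝓝 0, Metric.infDist x S ^ k ≤ sqSum φ (kGen n p φ) x := by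
    by_contra hcon
    simp only [not_exists, not_eventually, not_le] at hcon
    obtain ⟨f, hf, hfS, hfC⟩ := exists_flat_not_le h0S (sqSum_nonneg φ (kGen n p φ)) hcon
    obtain ⟨C, hC⟩ := (H f ⟨Set.univ, univ_mem, hf.contDiffOn,
      fun k x hx => hfS k x hx.1⟩).sqDominated
    exact hfC C hC
  obtain ⟨k, hk⟩ := h1
  obtain ⟨K, C, hC⟩ := exists_pow_sqSum_le hφ
  refine ⟨(max C 1)⁻¹, by positivity, (2 + k) * K, ?_⟩
  filter_upwards [hk, hC] with x hkx hCx
  have hd : Metric.infDist x S ≤ ‖x‖ := by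
    simpa using Metric.infDist_le_dist_of_mem (x := x) h0S
  have hd0 : 0 ≤ Metric.infDist x S := Metric.infDist_nonneg
  rw [inv_mul_le_iff₀ (by positivity), pow_mul, pow_add]
  calc (Metric.infDist x S ^ 2 * Metric.infDist x S ^ k) ^ K
      ≤ (‖x‖ ^ 2 * sqSum φ (kGen n p φ) x) ^ K := by gcongr
    _ ≤ C * sqSum φ (tGen n p φ) x := hCx
    _ ≤ max C 1 * sqSum φ (tGen n p φ) x :=
      mul_le_mul_of_nonneg_right (le_max_left _ _) (sqSum_nonneg φ _ x)

theorem analyticAt_sqSum_tGen (hφ : AnalyticAt ℝ φ 0) :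
    AnalyticAt ℝ (sqSum φ (tGen n p φ)) 0 := by
  refine (Finset.univ.analyticAt_fun_sum fun j _ => (coordGerm hφ j).2.fun_pow 2).fun_add
    (Finset.univ.analyticAt_fun_sum fun ι _ => ?_)
  split_ifs
  · exact (analyticAt_tGen hφ ι).fun_pow 2
  · exact analyticAt_const

theorem FlatOnSet.memIT (hφ : AnalyticAt ℝ φ 0) {S : Set (EuclideanSpace ℝ (Fin n))}
    (hS : IsClosed S) (h0S : (0 : EuclideanSpace ℝ (Fin n)) ∈ S) {c : ℝ} (hc : 0 < c) {β : ℕ}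
    (hβ : ∀ᶠ x in 𝓝 0, c * Metric.infDist x S ^ β ≤ sqSum φ (tGen n p φ) x)
    {h : EuclideanSpace ℝ (Fin n) → ℝ} (hh : FlatOnSet n S h) : MemIT n p φ h := by
  classical
  obtain ⟨U, hU, hhU, hhS⟩ := hh
  obtain ⟨W, hW, hWo, h0W⟩ := mem_nhds_iff.1 (hβ.and
    ((analyticAt_sqSum_tGen hφ).eventually_analyticAt.and (hφ.eventually_analyticAt.and
      ((eventually_all.2 fun ι =>
      (analyticAt_tGen hφ ι).eventually_analyticAt).and hU))))
  have hflat : IsFlatOn S W h := ⟨hhU.mono fun x hx => (hW hx).2.2.2.2,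
    fun k x hx => hhS k x ⟨hx.1, (hW hx.2).2.2.2.2⟩⟩
  have hu : ContDiffOn ℝ ∞ (fun x => (sqSum φ (tGen n p φ) x)⁻¹ * h x) W :=
    contDiffOn_infty.2 fun k => by
      simpa using hflat.contDiffOn_inv_smul hS ⟨0, h0S⟩ hWo
        (fun x hx => (hW hx).2.1.contDiffAt.contDiffWithinAt) hc (fun x hx => (hW hx).1) k 1
  refine ⟨W, hWo.mem_nhds h0W, fun j x => φ x j * ((sqSum φ (tGen n p φ) x)⁻¹ * h x),
    fun ι x => tGen n p φ ι x * ((sqSum φ (tGen n p φ) x)⁻¹ * h x), fun j => ?_, fun ι => ?_,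
    fun x hx => ?_⟩
  · refine ContDiffOn.mul (fun x hx => ?_) hu
    exact (((EuclideanSpace.proj (𝕜 := ℝ) j).analyticAt _).fun_comp
      (hW hx).2.2.1).contDiffAt.contDiffWithinAt
  · exact ContDiffOn.mul (fun x hx => ((hW hx).2.2.2.1 ι).contDiffAt.contDiffWithinAt) hu
  · have h1 : h x = sqSum φ (tGen n p φ) x * ((sqSum φ (tGen n p φ) x)⁻¹ * h x) := by
      by_cases hG : sqSum φ (tGen n p φ) x = 0
      · have h2 : c * Metric.infDist x S ^ β ≤ 0 := hG ▸ (hW hx).1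
        have h3 : x ∈ S := by
          by_contra hxS
          have h4 := (hS.notMem_iff_infDist_pos ⟨0, h0S⟩).1 hxS
          exact absurd h2 (not_le.2 (by positivity))
        rw [hflat.eq_zero ⟨h3, hx⟩, mul_zero, mul_zero]
      · rw [mul_inv_cancel_left₀ hG]
    refine h1.trans ?_
    beta_reduce
    generalize (sqSum φ (tGen n p φ) x)⁻¹ * h x = u
    rw [sqSum, add_mul, Finset.sum_mul, Finset.sum_mul]
    congr 1
    · exact Finset.sum_congr rfl fun j _ => by ring
    · refine Finset.sum_congr rfl fun ι _ => ?_
      split_ifs <;> ring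

end

end AnalyticGerms

theorem flat_subset_IK_iff_flat_subset_IT (n p : ℕ) (hp : 1 ≤ p) (hpn : p < n)
    (S : Set (EuclideanSpace ℝ (Fin n))) (hS : IsClosed S)
    (h0S : (0 : EuclideanSpace ℝ (Fin n)) ∈ S) (hcoh : CoherentSet n S)
    (φ : EuclideanSpace ℝ (Fin n) → EuclideanSpace ℝ (Fin p))
    (U : Set (EuclideanSpace ℝ (Fin n))) (hU : U ∈ nhds 0)
    (hφ : AnalyticOnNhd ℝ φ U) (hφ0 : φ 0 = 0) :
    (∀ h, FlatOnSet n S h → MemIK n p φ h) ↔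
      (∀ h, FlatOnSet n S h → MemIT n p φ h) := by
  refine ⟨fun H h hh => ?_, fun H h hh => (H h hh).memIK⟩
  have hφa : AnalyticAt ℝ φ 0 := hφ 0 (mem_of_mem_nhds hU)
  obtain ⟨c, hc, β, hβ⟩ := exists_mul_infDist_pow_le_sqSum hφa h0S H
  exact hh.memIT hφa hS h0S hc hβ
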